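/- arXiv:math/0101076 — 2 statements merged into one kernel-verified Lean document; each statement's English description precedes it below -/
import Mathlib

section
/- The multiplex M^{d,n} (with d ≥ 2) is combinatorially isomorphic to a proper face of some multiplex if and only if d ≤ n ≤ 2d-1. -/
open Set

variable {E : Type*} [NormedAddCommGroup E] [NormedSpace ℝ E]

/-- The dimension of a (nonempty convex) set: the dimension of its affine span. -/
noncomputable def pdim (F : Set E) : ℕ := Module.finrank ℝ (affineSpan ℝ F).direction

/-- `F` is a (nonempty) face of the polytope `P`. -/
def IsFaceOf (P F : Set E) : Prop := IsExposed ℝ P F ∧ F.Nonempty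

/-- The number of `i`-dimensional faces of `P`. -/
noncomputable def faceCount (P : Set E) (i : ℕ) : ℕ :=
  {F : Set E | IsFaceOf P F ∧ pdim F = i}.ncard

/-- The flag number `f_S(P)`: the number of chains of faces of `P` whose set of
dimensions is `S`.  A chain is recorded as a function `c : ℕ → Set E` that assigns
to each `s ∈ S` a face of dimension `s`, increasingly with `s`, and `∅` off `S`. -/
noncomputable def flagNum (P : Set E) (S : Finset ℕ) : ℕ :=
  {c : ℕ → Set E | (∀ s ∈ S, IsFaceOf P (c s) ∧ pdim (c s) = s) ∧
    (∀ s ∈ S, ∀ t ∈ S, s ≤ t → c s ⊆ c t) ∧ ∀ s, s ∉ S → c s = ∅}.ncard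

/-- `P` is the multiplex `M^{d,n}` with ordered vertices `x 0, …, x n`, where the
vertex list is extended to all integer indices by the conventions `x j = x 0` for
`j < 0` and `x j = x n` for `j > n`.  Its facets are exactly the sets
`F i = conv{x (i-d+1), …, x (i-1), x (i+1), …, x (i+d-1)}` for `0 ≤ i ≤ n`. -/
structure IsMultiplex (d n : ℕ) (P : Set E) (x : ℤ → E) : Prop where
  two_le_d : 2 ≤ d
  d_le_n : d ≤ n
  clamp_lo : ∀ j : ℤ, j ≤ 0 → x j = x 0
  clamp_hi : ∀ j : ℤ, (n : ℤ) ≤ j → x j = x n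
  inj : Set.InjOn x (Icc (0:ℤ) (n:ℤ))
  hull : P = convexHull ℝ (x '' Icc (0:ℤ) (n:ℤ))
  verts : Set.extremePoints ℝ P = x '' Icc (0:ℤ) (n:ℤ)
  dim : pdim P = d
  facets : ∀ F : Set E, (IsFaceOf P F ∧ pdim F = d - 1) ↔
      ∃ i ∈ Icc (0:ℤ) (n:ℤ),
        F = convexHull ℝ (x '' (Icc (i - d + 1) (i + d - 1) \ {i}))

/-- The set of (nonempty) faces of a polytope. -/
def facesOf (P : Set E) : Set (Set E) := {F | IsFaceOf P F}

/-- Two polytopes are combinatorially isomorphic if their face posets (ordered by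
inclusion) are order isomorphic. -/
def CombEquiv {E' : Type*} [NormedAddCommGroup E'] [NormedSpace ℝ E']
    (P : Set E) (Q : Set E') : Prop :=
  Nonempty ((facesOf P) ≃o (facesOf Q))


namespace MPX

lemma face_iff {P F : Set E} : IsFaceOf P F ↔ F.Nonempty ∧ ∃ l : StrongDual ℝ E, ∃ c : ℝ,
    (∀ z ∈ P, l z ≤ c) ∧ F = {z ∈ P | l z = c} := by
  constructor
  · rintro ⟨h, hne⟩
    refine ⟨hne, ?_⟩
    obtain ⟨l, hl⟩ := h hne
    obtain ⟨g, hg⟩ := hne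
    have hg' := hg
    rw [hl] at hg'
    refine ⟨l, l g, hg'.2, ?_⟩
    rw [hl]
    ext z
    constructor
    · rintro ⟨h1, h2⟩
      exact ⟨h1, le_antisymm (hg'.2 z h1) (h2 g hg'.1)⟩
    · rintro ⟨h1, h2⟩
      exact ⟨h1, fun y hy => h2 ▸ hg'.2 y hy⟩
  · rintro ⟨hne, l, c, hle, rfl⟩
    refine ⟨fun _ => ⟨l, ?_⟩, hne⟩
    obtain ⟨g, hg⟩ := hne
    ext z
    constructor
    · rintro ⟨h1, h2⟩
      exact ⟨h1, fun y hy => h2 ▸ hle y hy⟩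
    · rintro ⟨h1, h2⟩
      exact ⟨h1, le_antisymm (hle z h1) (hg.2 ▸ h2 g hg.1)⟩

lemma le_on_hull {X : Set E} (l : StrongDual ℝ E) {c : ℝ} (h : ∀ z ∈ X, l z ≤ c) :
    ∀ z ∈ convexHull ℝ X, l z ≤ c := by
  intro z hz
  have hc : Convex ℝ {w : E | l w ≤ c} := convex_halfSpace_le l.toLinearMap.isLinear c
  exact convexHull_min (fun w hw => h w hw) hc hz

lemma eq_on_hull {X : Set E} (l : StrongDual ℝ E) {c : ℝ} (h : ∀ z ∈ X, l z = c) :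
    ∀ z ∈ convexHull ℝ X, l z = c := by
  intro z hz
  have hc : Convex ℝ {w : E | l w = c} := convex_hyperplane l.toLinearMap.isLinear c
  exact convexHull_min (fun w hw => h w hw) hc hz

lemma hull_compact {X : Set E} (hX : X.Finite) : IsCompact (convexHull ℝ X) :=
  hX.isCompact_convexHull ℝ

lemma face_eq_hull {X F : Set E} (hX : X.Finite) (hF : IsExposed ℝ (convexHull ℝ X) F) :
    F = convexHull ℝ (X ∩ F) := by
  have hcv : Convex ℝ F := hF.convex (convex_convexHull ℝ X)
  have hcp : IsCompact F := hF.isCompact (hull_compact hX)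
  apply subset_antisymm
  · have h1 := closure_convexHull_extremePoints hcp hcv
    have h2 : F.extremePoints ℝ ⊆ X ∩ F := by
      intro v hv
      exact ⟨extremePoints_convexHull_subset (hF.isExtreme.extremePoints_subset_extremePoints hv),
        hv.1⟩
    have h3 : closure (convexHull ℝ (F.extremePoints ℝ)) ⊆ closure (convexHull ℝ (X ∩ F)) :=
      closure_mono (convexHull_mono h2)
    rw [h1, (hull_compact (hX.inter_of_left F)).isClosed.closure_eq] at h3
    exact h3
  · exact convexHull_min inter_subset_right hcv

lemma pdim_eq (F : Set E) : pdim F = Module.finrank ℝ (vectorSpan ℝ F) := by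
  rw [pdim, direction_affineSpan]

lemma vectorSpan_hull (F : Set E) : vectorSpan ℝ (convexHull ℝ F) = vectorSpan ℝ F := by
  rw [← direction_affineSpan, ← direction_affineSpan, affineSpan_convexHull]

lemma fd_hull {X : Set E} (hX : X.Finite) :
    FiniteDimensional ℝ (vectorSpan ℝ (convexHull ℝ X)) := by
  rw [vectorSpan_hull]
  exact finiteDimensional_vectorSpan_of_finite ℝ hX

lemma vs_le_ker {F : Set E} (l : StrongDual ℝ E) {c : ℝ} (h : ∀ z ∈ F, l z = c) :
    vectorSpan ℝ F ≤ LinearMap.ker l.toLinearMap := by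
  rw [vectorSpan_def, Submodule.span_le]
  rintro _ ⟨a, ha, b, hb, rfl⟩
  simp [h a ha, h b hb]

lemma const_of_ker {F : Set E} (l : StrongDual ℝ E)
    (h : vectorSpan ℝ F ≤ LinearMap.ker l.toLinearMap) {a b : E} (ha : a ∈ F) (hb : b ∈ F) :
    l a = l b := by
  have := h (vsub_mem_vectorSpan ℝ ha hb)
  simp at this
  linarith

/-- proper faces have smaller dimension -/
lemma pdim_lt {P F : Set E} [FiniteDimensional ℝ (vectorSpan ℝ P)] (hF : IsFaceOf P F)
    (hne : F ≠ P) : pdim F < pdim P := by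
  obtain ⟨⟨g, hg⟩, l, c, hle, rfl⟩ := face_iff.1 hF
  rw [pdim_eq, pdim_eq]
  apply Submodule.finrank_lt_finrank_of_lt
  refine lt_of_le_of_ne (vectorSpan_mono ℝ (fun z hz => hz.1)) ?_
  intro heq
  apply hne
  have hk : vectorSpan ℝ P ≤ LinearMap.ker l.toLinearMap := by
    rw [← heq]; exact vs_le_ker l (fun z hz => hz.2)
  ext z
  refine ⟨fun h => h.1, fun h => ⟨h, ?_⟩⟩
  rw [const_of_ker l hk h hg.1, hg.2]

lemma exists_functional (W : Submodule ℝ E) [FiniteDimensional ℝ W] {w : E} (hw : w ∉ W) :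
    ∃ m : StrongDual ℝ E, (∀ a ∈ W, m a = 0) ∧ m w ≠ 0 := by
  obtain ⟨f, u, h1, h2⟩ := geometric_hahn_banach_closed_point (s := (W : Set E)) W.convex
    W.closed_of_finiteDimensional hw
  have h0 := h1 0 W.zero_mem
  simp at h0
  refine ⟨f, fun a ha => ?_, by linarith⟩
  by_contra hne
  have := h1 ((u / f a) • a) (W.smul_mem _ ha)
  simp [hne] at this

/-- rotation step -/
lemma rotate {X G : Set E} (hX : X.Finite) (hG : IsFaceOf (convexHull ℝ X) G)
    (hdim : pdim G + 1 < pdim (convexHull ℝ X)) :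
    ∃ G', IsFaceOf (convexHull ℝ X) G' ∧ G' ≠ convexHull ℝ X ∧ G ⊆ G' ∧
      ∃ v ∈ X, v ∈ G' ∧ v ∉ G := by
  set P := convexHull ℝ X with hP
  have : FiniteDimensional ℝ (vectorSpan ℝ P) := fd_hull hX
  obtain ⟨⟨g, hg⟩, l, c, hle, hGe⟩ := face_iff.1 hG
  have hGP : G ⊆ P := by rw [hGe]; exact fun z hz => hz.1
  have hWD : vectorSpan ℝ G ≤ vectorSpan ℝ P := vectorSpan_mono ℝ hGP
  have : FiniteDimensional ℝ (vectorSpan ℝ G) := Submodule.finiteDimensional_of_le hWD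
  obtain ⟨w, hwD, hlw, hwW⟩ : ∃ w ∈ vectorSpan ℝ P, l w = 0 ∧ w ∉ vectorSpan ℝ G := by
    by_contra hcon
    push Not at hcon
    let f := l.toLinearMap.domRestrict (vectorSpan ℝ P)
    have h1 := f.finrank_range_add_finrank_ker
    have h2 : Module.finrank ℝ (LinearMap.range f) ≤ 1 := by
      have := Submodule.finrank_le (LinearMap.range f)
      simpa using this
    have h3 : Module.finrank ℝ (LinearMap.ker f) ≤ Module.finrank ℝ (vectorSpan ℝ G) := by
      let j : LinearMap.ker f →ₗ[ℝ] vectorSpan ℝ G :=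
        LinearMap.codRestrict _ ((vectorSpan ℝ P).subtype ∘ₗ (LinearMap.ker f).subtype)
          (fun z => hcon z.1.1 z.1.2 z.2)
      refine LinearMap.finrank_le_finrank_of_injective (f := j) ?_
      intro a b hab
      have := congrArg Subtype.val hab
      exact Subtype.ext (Subtype.ext this)
    rw [pdim_eq, pdim_eq] at hdim
    omega
  obtain ⟨m0, hm0W, hm0w⟩ := exists_functional (vectorSpan ℝ G) hwW
  have key : ∀ m : StrongDual ℝ E, (∀ a ∈ vectorSpan ℝ G, m a = 0) → m w ≠ 0 →
      (∃ v ∈ X, m g < m v) → ∃ G', IsFaceOf P G' ∧ G' ≠ P ∧ G ⊆ G' ∧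
      ∃ v ∈ X, v ∈ G' ∧ v ∉ G := by
    rintro m hmW hmw ⟨v1, hv1X, hv1⟩
    have hmG : ∀ z ∈ G, m z = m g := fun z hz => by
      have := hmW _ (vsub_mem_vectorSpan ℝ hz hg)
      simp at this; linarith
    have hlG : ∀ z ∈ G, l z = c := fun z hz => by rw [hGe] at hz; exact hz.2
    let Y := {v ∈ X | m g < m v}
    have hYf : Y.Finite := hX.subset (fun z hz => hz.1)
    obtain ⟨v0, hv0, hmin⟩ := Set.exists_min_image Y (fun v => (c - l v) / (m v - m g)) hYf
      ⟨v1, hv1X, hv1⟩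
    have hv0G : v0 ∉ G := fun h => by have := hmG _ h; have := hv0.2; linarith
    have hv0P : v0 ∈ P := subset_convexHull ℝ X hv0.1
    have hlv0 : l v0 < c := lt_of_le_of_ne (hle _ hv0P) (fun h => hv0G (by rw [hGe]; exact ⟨hv0P, h⟩))
    set r := (c - l v0) / (m v0 - m g) with hr
    have hrpos : 0 < r := div_pos (by linarith) (by linarith [hv0.2])
    have hrmul : r * (m v0 - m g) = c - l v0 := by
      rw [hr, div_mul_cancel₀]; linarith [hv0.2]
    have hle' : ∀ z ∈ P, (l + r • m) z ≤ c + r * m g := by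
      apply le_on_hull
      intro z hz
      have hzc := hle z (subset_convexHull ℝ X hz)
      simp only [_root_.add_apply, _root_.smul_apply, smul_eq_mul]
      rcases lt_or_ge (m g) (m z) with h | h
      · have := hmin z ⟨hz, h⟩
        rw [le_div_iff₀ (by linarith)] at this
        linarith
      · nlinarith
    refine ⟨{z ∈ P | (l + r • m) z = c + r * m g}, face_iff.2 ⟨⟨g, hGP hg, ?_⟩, l + r • m, _, hle', rfl⟩,
      ?_, ?_, v0, hv0.1, ⟨hv0P, ?_⟩, hv0G⟩
    · simp [hlG g hg]
    · intro heq
      have hk : vectorSpan ℝ P ≤ LinearMap.ker (l + r • m).toLinearMap := by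
        apply vs_le_ker (c := c + r * m g)
        intro z hz
        rw [← heq] at hz
        exact hz.2
      have := hk hwD
      simp [hlw, hmw, hrpos.ne'] at this
    · intro z hz
      exact ⟨hGP hz, by simp [hlG z hz, hmG z hz]⟩
    · simp; linarith
  by_cases h1 : ∃ v ∈ X, m0 g < m0 v
  · exact key m0 hm0W hm0w h1
  by_cases h2 : ∃ v ∈ X, m0 v < m0 g
  · refine key (-m0) (fun a ha => by simp [hm0W a ha]) (by simpa using hm0w) ?_
    obtain ⟨v, hv, h⟩ := h2
    exact ⟨v, hv, by simpa using h⟩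
  exfalso
  push Not at h1 h2
  apply hm0w
  have := vs_le_ker m0 (eq_on_hull m0 (c := m0 g) (fun z hz => le_antisymm (h1 z hz) (h2 z hz))) hwD
  simpa using this

/-- every proper face lies in a facet -/
lemma exists_facet {X : Set E} (hX : X.Finite) {G : Set E} (hG : IsFaceOf (convexHull ℝ X) G)
    (hne : G ≠ convexHull ℝ X) :
    ∃ H, IsFaceOf (convexHull ℝ X) H ∧ pdim H = pdim (convexHull ℝ X) - 1 ∧ G ⊆ H := by
  have : FiniteDimensional ℝ (vectorSpan ℝ (convexHull ℝ X)) := fd_hull hX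
  induction hk : (X \ G).ncard using Nat.strong_induction_on generalizing G with
  | _ k ih =>
    have hlt := pdim_lt hG hne
    by_cases hd : pdim G = pdim (convexHull ℝ X) - 1
    · exact ⟨G, hG, hd, subset_rfl⟩
    obtain ⟨G', h1, h2, h3, v, hvX, hv1, hv2⟩ := rotate hX hG (by omega)
    obtain ⟨H, a, b, c⟩ := ih (X \ G').ncard (by
      rw [← hk]
      apply Set.ncard_lt_ncard _ (hX.subset sdiff_subset)
      refine ⟨sdiff_subset_sdiff_right h3, fun h => ?_⟩
      exact (h ⟨hvX, hv2⟩).2 hv1) h1 h2 rfl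
    exact ⟨H, a, b, h3.trans c⟩


lemma vertex_of_mem_hull {P B : Set E} {v : E} (hP : Convex ℝ P) (hBP : B ⊆ P)
    (hv : v ∈ P.extremePoints ℝ) (h : v ∈ convexHull ℝ B) : v ∈ B :=
  extremePoints_convexHull_subset
    (inter_extremePoints_subset_extremePoints_of_subset (convexHull_min hBP hP) ⟨h, hv⟩)

/-- vertices of a polytope are faces -/
lemma vertex_face {X : Set E} (hX : X.Finite) (hext : (convexHull ℝ X).extremePoints ℝ = X)
    {v : E} (hv : v ∈ X) : IsFaceOf (convexHull ℝ X) {v} := by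
  have hvP : v ∈ convexHull ℝ X := subset_convexHull ℝ X hv
  have hnot : v ∉ convexHull ℝ (X \ {v}) := fun h =>
    (vertex_of_mem_hull (convex_convexHull ℝ X)
      (sdiff_subset.trans (subset_convexHull ℝ X)) (hext.symm ▸ hv) h).2 rfl
  obtain ⟨l, u, h1, h2⟩ := geometric_hahn_banach_closed_point (convex_convexHull ℝ (X \ {v}))
    (hull_compact (hX.subset sdiff_subset)).isClosed hnot
  have hle : ∀ z ∈ convexHull ℝ X, l z ≤ l v := by
    apply le_on_hull
    intro z hz
    by_cases h : z = v
    · rw [h]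
    · exact ((h1 z (subset_convexHull ℝ _ ⟨hz, h⟩)).trans h2).le
  have hface : IsFaceOf (convexHull ℝ X) {z ∈ convexHull ℝ X | l z = l v} :=
    face_iff.2 ⟨⟨v, hvP, rfl⟩, l, _, hle, rfl⟩
  have heq := face_eq_hull hX hface.1
  have : X ∩ {z ∈ convexHull ℝ X | l z = l v} = {v} := by
    ext z
    constructor
    · rintro ⟨hz, _, h⟩
      by_contra hne
      have := (h1 z (subset_convexHull ℝ _ ⟨hz, hne⟩)).trans h2
      linarith
    · rintro rfl
      exact ⟨hv, hvP, rfl⟩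
  rw [this, convexHull_singleton] at heq
  rwa [heq] at hface

lemma exists_vertex_mem {X G : Set E} (hX : X.Finite) (hG : IsFaceOf (convexHull ℝ X) G) :
    ∃ v ∈ X, v ∈ G := by
  obtain ⟨g, hg⟩ := hG.2
  rw [face_eq_hull hX hG.1] at hg
  obtain ⟨v, hv⟩ := (convexHull_nonempty_iff (𝕜 := ℝ)).1 ⟨g, hg⟩
  exact ⟨v, hv.1, hv.2⟩

lemma isMin_vertex {X : Set E} (hX : X.Finite) (hext : (convexHull ℝ X).extremePoints ℝ = X)
    {v : E} (hv : v ∈ X) :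
    IsMin (⟨{v}, vertex_face hX hext hv⟩ : facesOf (convexHull ℝ X)) := by
  rintro ⟨G, hG⟩ hle
  obtain ⟨w, hw, hwG⟩ := exists_vertex_mem hX hG
  have : w = v := hle hwG
  subst this
  exact singleton_subset_iff.2 hwG

lemma eq_vertex_of_isMin {X : Set E} (hX : X.Finite)
    (hext : (convexHull ℝ X).extremePoints ℝ = X)
    {G : facesOf (convexHull ℝ X)} (hG : IsMin G) : ∃ v ∈ X, G.1 = {v} := by
  obtain ⟨w, hw, hwG⟩ := exists_vertex_mem hX G.2
  refine ⟨w, hw, ?_⟩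
  have h1 : (⟨{w}, vertex_face hX hext hw⟩ : facesOf (convexHull ℝ X)) ≤ G :=
    singleton_subset_iff.2 hwG
  exact subset_antisymm (hG h1) h1

lemma mem_iff {d n : ℕ} {P : Set E} {x : ℤ → E} (hM : IsMultiplex d n P x) {k j : ℤ}
    (hk : k ∈ Icc (0:ℤ) n) :
    x k ∈ convexHull ℝ (x '' (Icc (j - d + 1) (j + d - 1) \ {j})) ↔
      ∃ t : ℤ, j - d + 1 ≤ t ∧ t ≤ j + d - 1 ∧ t ≠ j ∧
        (t = k ∨ (t ≤ 0 ∧ k = 0) ∨ ((n:ℤ) ≤ t ∧ k = n)) := by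
  have hall : ∀ t, x t ∈ x '' Icc (0:ℤ) n := by
    intro t
    rcases le_total t 0 with h | h
    · rw [hM.clamp_lo t h]; exact ⟨0, by simp, rfl⟩
    rcases le_total t n with h' | h'
    · exact ⟨t, ⟨h, h'⟩, rfl⟩
    · rw [hM.clamp_hi t h']; exact ⟨n, by simp, rfl⟩
  constructor
  · intro h
    have hcv : Convex ℝ P := by rw [hM.hull]; exact convex_convexHull ℝ _
    have hsub : x '' (Icc (j - d + 1) (j + d - 1) \ {j}) ⊆ P := by
      rintro _ ⟨t, _, rfl⟩
      rw [hM.hull]; exact subset_convexHull ℝ _ (hall t)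
    obtain ⟨t, ⟨⟨h1, h2⟩, h3⟩, ht⟩ := vertex_of_mem_hull hcv hsub
      (hM.verts.symm ▸ ⟨k, hk, rfl⟩) h
    refine ⟨t, h1, h2, h3, ?_⟩
    rcases le_total t 0 with h | h
    · rw [hM.clamp_lo t h] at ht
      exact Or.inr (Or.inl ⟨h, (hM.inj (by simp) hk ht).symm⟩)
    rcases le_total t n with h' | h'
    · exact Or.inl (hM.inj ⟨h, h'⟩ hk ht)
    · rw [hM.clamp_hi t h'] at ht
      exact Or.inr (Or.inr ⟨h', (hM.inj (by simp) hk ht).symm⟩)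
  · rintro ⟨t, h1, h2, h3, h4⟩
    apply subset_convexHull
    refine ⟨t, ⟨⟨h1, h2⟩, h3⟩, ?_⟩
    rcases h4 with rfl | ⟨h, rfl⟩ | ⟨h, rfl⟩
    · rfl
    · exact hM.clamp_lo t h
    · exact hM.clamp_hi t h

lemma finX (x : ℤ → E) (n : ℕ) : (x '' Icc (0:ℤ) n).Finite := (Set.finite_Icc _ _).image x

lemma hextX {d n : ℕ} {P : Set E} {x : ℤ → E} (hM : IsMultiplex d n P x) :
    (convexHull ℝ (x '' Icc (0:ℤ) n)).extremePoints ℝ = x '' Icc (0:ℤ) n := by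
  rw [← hM.hull, hM.verts]

lemma face_in_facet {d n : ℕ} {P : Set E} {x : ℤ → E} (hM : IsMultiplex d n P x) {G : Set E}
    (hG : IsFaceOf P G) (hne : G ≠ P) : ∃ i ∈ Icc (0:ℤ) n,
      IsFaceOf P (convexHull ℝ (x '' (Icc (i - d + 1) (i + d - 1) \ {i}))) ∧
      G ⊆ convexHull ℝ (x '' (Icc (i - d + 1) (i + d - 1) \ {i})) := by
  have hd := hM.dim
  have hh := hM.hull
  rw [hh] at hG hne hd
  obtain ⟨H, h1, h2, h3⟩ := exists_facet (finX x n) hG hne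
  rw [hd] at h2
  rw [← hh] at h1
  obtain ⟨i, hi, rfl⟩ := (hM.facets H).1 ⟨h1, h2⟩
  exact ⟨i, hi, h1, h3⟩

/-- The combinatorial property distinguishing faces. -/
def Prp (α : Type*) [PartialOrder α] : Prop :=
  ∃ G m1 m2 : α, IsMin m1 ∧ ¬ m1 ≤ G ∧ ∀ m, IsMin m → ¬ m ≤ G → m = m1 ∨ m = m2

lemma Prp.transfer {α β : Type*} [PartialOrder α] [PartialOrder β] (e : α ≃o β) (h : Prp α) :
    Prp β := by
  obtain ⟨G, m1, m2, h1, h2, h3⟩ := h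
  refine ⟨e G, e m1, e m2, e.isMin_apply.2 h1, by simpa using h2, fun m hm hmG => ?_⟩
  have := h3 (e.symm m) (e.symm.isMin_apply.2 hm) (by rwa [e.symm_apply_le])
  rcases this with h | h
  · left; rw [← h]; simp
  · right; rw [← h]; simp

/-- large multiplexes do not have the property -/
lemma not_prp {d n : ℕ} {P : Set E} {x : ℤ → E} (hM : IsMultiplex d n P x) (hn : 2 * d ≤ n) :
    ¬ Prp (facesOf P) := by
  rintro ⟨G, m1, m2, h1, h2, h3⟩
  have hGne : G.1 ≠ P := by
    intro h
    apply h2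
    change m1.1 ⊆ G.1
    rw [h]
    exact m1.2.1.subset
  obtain ⟨i, hi, -, hGi⟩ := face_in_facet hM G.2 hGne
  have hP := hM.hull
  have hext := hextX hM
  have hfin := finX x n
  have hd2 := hM.two_le_d
  subst hP
  -- three vertices missed by the facet
  have key : ∀ k ∈ Icc (0:ℤ) n, (¬ ∃ t : ℤ, i - d + 1 ≤ t ∧ t ≤ i + d - 1 ∧ t ≠ i ∧
        (t = k ∨ (t ≤ 0 ∧ k = 0) ∨ ((n:ℤ) ≤ t ∧ k = n))) → m1.1 = {x k} ∨ m2.1 = {x k} := by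
    intro k hk hnot
    have hxk : x k ∈ x '' Icc (0:ℤ) n := ⟨k, hk, rfl⟩
    rcases h3 _ (isMin_vertex hfin hext hxk) (by
      intro hle
      exact hnot ((mem_iff hM hk).1 (hGi (hle rfl)))) with h | h
    · left; rw [← h]
    · right; rw [← h]
  have fin3 : ∀ a b c : ℤ, a ∈ Icc (0:ℤ) n → b ∈ Icc (0:ℤ) n → c ∈ Icc (0:ℤ) n →
      a ≠ b → a ≠ c → b ≠ c → (m1.1 = {x a} ∨ m2.1 = {x a}) → (m1.1 = {x b} ∨ m2.1 = {x b}) →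
      (m1.1 = {x c} ∨ m2.1 = {x c}) → False := by
    intro a b c ha hb hc hab hac hbc h1 h2 h3
    have e : ∀ a b : ℤ, a ∈ Icc (0:ℤ) n → b ∈ Icc (0:ℤ) n → ∀ S : Set E, S = {x a} → S = {x b} →
        a = b := by
      intro a b ha hb S h h'
      exact hM.inj ha hb (singleton_injective (h ▸ h'))
    have e1 := e a b ha hb
    have e2 := e a c ha hc
    have e3 := e b c hb hc
    grind
  obtain ⟨hi0, hin⟩ := hi
  have hnd : (2 * d : ℤ) ≤ n := by exact_mod_cast hn
  have hdd : (2 : ℤ) ≤ d := by exact_mod_cast hd2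
  by_cases c1 : i = 0
  · exact fin3 (n - 2) (n - 1) n ⟨by omega, by omega⟩ ⟨by omega, by omega⟩ ⟨by omega, by omega⟩
      (by omega) (by omega) (by omega)
      (key _ ⟨by omega, by omega⟩ (by rintro ⟨t, ht⟩; omega))
      (key _ ⟨by omega, by omega⟩ (by rintro ⟨t, ht⟩; omega))
      (key _ ⟨by omega, by omega⟩ (by rintro ⟨t, ht⟩; omega))
  by_cases c2 : i = n
  · exact fin3 0 1 2 ⟨by omega, by omega⟩ ⟨by omega, by omega⟩ ⟨by omega, by omega⟩
      (by omega) (by omega) (by omega)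
      (key _ ⟨by omega, by omega⟩ (by rintro ⟨t, ht⟩; omega))
      (key _ ⟨by omega, by omega⟩ (by rintro ⟨t, ht⟩; omega))
      (key _ ⟨by omega, by omega⟩ (by rintro ⟨t, ht⟩; omega))
  have ki := key i ⟨hi0, hin⟩ (by rintro ⟨t, ht⟩; omega)
  by_cases c3 : i + d ≤ n - 1
  · exact fin3 (n - 1) n i ⟨by omega, by omega⟩ ⟨by omega, by omega⟩ ⟨by omega, by omega⟩
      (by omega) (by omega) (by omega)
      (key _ ⟨by omega, by omega⟩ (by rintro ⟨t, ht⟩; omega))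
      (key _ ⟨by omega, by omega⟩ (by rintro ⟨t, ht⟩; omega)) ki
  by_cases c4 : d + 1 ≤ i
  · exact fin3 0 1 i ⟨by omega, by omega⟩ ⟨by omega, by omega⟩ ⟨by omega, by omega⟩
      (by omega) (by omega) (by omega)
      (key _ ⟨by omega, by omega⟩ (by rintro ⟨t, ht⟩; omega))
      (key _ ⟨by omega, by omega⟩ (by rintro ⟨t, ht⟩; omega)) ki
  · exact fin3 0 n i ⟨by omega, by omega⟩ ⟨by omega, by omega⟩ ⟨by omega, by omega⟩
      (by omega) (by omega) (by omega)
      (key _ ⟨by omega, by omega⟩ (by rintro ⟨t, ht⟩; omega))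
      (key _ ⟨by omega, by omega⟩ (by rintro ⟨t, ht⟩; omega)) ki


/-- proper faces (with at least three vertices) of a multiplex have the property -/
lemma face_prp {d n : ℕ} {Q F : Set E} {y : ℤ → E} (hM : IsMultiplex d n Q y)
    (hF : IsFaceOf Q F) (hne : F ≠ Q)
    (h3 : ∃ M : Fin 3 → facesOf F, Function.Injective M ∧ ∀ i, IsMin (M i)) :
    Prp (facesOf F) := by
  obtain ⟨s, hs, -, hFs⟩ := face_in_facet hM hF hne
  have hd2 := hM.two_le_d
  have hdn := hM.d_le_n
  set X := y '' Icc (0:ℤ) n with hX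
  have hfin : X.Finite := finX y n
  have hFX : F = convexHull ℝ (X ∩ F) := by
    have := hF.1
    rw [hM.hull] at this
    exact face_eq_hull hfin this
  have hfinF : (X ∩ F).Finite := hfin.inter_of_left F
  have hextF : (convexHull ℝ (X ∩ F)).extremePoints ℝ = X ∩ F := by
    rw [← hFX, hF.1.isExtreme.extremePoints_eq, hM.verts, inter_comm]
  -- index set
  let V : Set ℤ := {k | k ∈ Icc (0:ℤ) n ∧ y k ∈ F}
  have hVfin : V.Finite := (Set.finite_Icc (0:ℤ) n).subset (fun k hk => hk.1)
  have hminV : ∀ G : facesOf F, IsMin G → ∃ k ∈ V, G.1 = {y k} := by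
    rw [hFX]
    intro G hG
    obtain ⟨v, ⟨⟨k, hk, rfl⟩, hv⟩, h⟩ := eq_vertex_of_isMin hfinF hextF hG
    exact ⟨k, ⟨hk, hv⟩, h⟩
  have hface : ∀ k ∈ V, IsFaceOf F {y k} := by
    intro k hk
    have := vertex_face hfinF hextF (v := y k) ⟨⟨k, hk.1, rfl⟩, hk.2⟩
    rwa [← hFX] at this
  have hVmin : ∀ k (hk : k ∈ V), IsMin (⟨{y k}, hface k hk⟩ : facesOf F) := by
    intro k hk
    rintro ⟨G, hG⟩ hle
    obtain ⟨g, hg⟩ := hG.2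
    have : g = y k := hle hg
    subst this
    exact singleton_subset_iff.2 hg
  obtain ⟨M, hMinj, hMmin⟩ := h3
  choose kk hkV hkM using fun i => hminV (M i) (hMmin i)
  have hkk : Function.Injective kk := by
    intro i j hij
    apply hMinj
    apply Subtype.ext
    rw [hkM, hkM, hij]
  have k01 : kk 0 ≠ kk 1 := fun h => by simpa using hkk h
  have k02 : kk 0 ≠ kk 2 := fun h => by simpa using hkk h
  have k12 : kk 1 ≠ kk 2 := fun h => by simpa using hkk h
  -- main construction
  have main : ∀ j ∈ Icc (0:ℤ) n, ∀ b1 ∈ V, ∀ b2 ∈ V,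
      (y b1 ∉ convexHull ℝ (y '' (Icc (j - d + 1) (j + d - 1) \ {j}))) →
      (∀ k ∈ V, k ≠ b1 → k ≠ b2 → y k ∈ convexHull ℝ (y '' (Icc (j - d + 1) (j + d - 1) \ {j}))) →
      Prp (facesOf F) := by
    intro j hj b1 hb1 b2 hb2 hnot hall
    obtain ⟨hHf, -⟩ := (hM.facets _).2 ⟨j, hj, rfl⟩
    set H := convexHull ℝ (y '' (Icc (j - d + 1) (j + d - 1) \ {j})) with hH
    have hGne : (F ∩ H).Nonempty := by
      have : ∃ i, kk i ≠ b1 ∧ kk i ≠ b2 := by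
        by_contra hcon
        push Not at hcon
        have a0 := hcon 0
        have a1 := hcon 1
        have a2 := hcon 2
        omega
      obtain ⟨i, hi1, hi2⟩ := this
      exact ⟨y (kk i), (hkV i).2, hall _ (hkV i) hi1 hi2⟩
    have hG : IsFaceOf F (F ∩ H) :=
      ⟨(hF.1.inter hHf.1).mono hF.1.subset inter_subset_left, hGne⟩
    refine ⟨⟨F ∩ H, hG⟩, ⟨{y b1}, hface _ hb1⟩, ⟨{y b2}, hface _ hb2⟩, hVmin _ hb1, ?_, ?_⟩
    · intro hle
      exact hnot (hle rfl).2
    · intro m hm hmle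
      obtain ⟨k, hk, hmk⟩ := hminV m hm
      by_cases e1 : k = b1
      · left; apply Subtype.ext; rw [hmk, e1]
      by_cases e2 : k = b2
      · right; apply Subtype.ext; rw [hmk, e2]
      exfalso
      apply hmle
      change m.1 ⊆ F ∩ H
      rw [hmk]
      exact singleton_subset_iff.2 ⟨hk.2, hall k hk e1 e2⟩
  obtain ⟨a, ha, hamin⟩ := Set.exists_min_image V id hVfin ⟨kk 0, hkV 0⟩
  obtain ⟨b, hb, hbmax⟩ := Set.exists_max_image V id hVfin ⟨kk 0, hkV 0⟩
  simp only [id] at hamin hbmax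
  have hdd : (2 : ℤ) ≤ d := by exact_mod_cast hd2
  obtain ⟨⟨ha0, han⟩, haF⟩ := id ha
  obtain ⟨⟨hb0, hbn⟩, hbF⟩ := id hb
  have hsp : b - a ≤ 2 * d - 2 := by
    obtain ⟨t, ht⟩ := (mem_iff hM ha.1).1 (hFs haF)
    obtain ⟨t', ht'⟩ := (mem_iff hM hb.1).1 (hFs hbF)
    obtain ⟨hs0, hsn⟩ := hs
    omega
  by_cases hba : (d : ℤ) ≤ b - a
  · have hj : b - d ∈ Icc (0:ℤ) n := ⟨by omega, by omega⟩
    have hnb : y b ∉ convexHull ℝ (y '' (Icc (b - d - d + 1) (b - d + d - 1) \ {(b:ℤ) - d})) := by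
      rw [mem_iff hM hb.1]
      rintro ⟨t, ht⟩; omega
    have hin : ∀ k ∈ V, k ≠ b → k ≠ b - d →
        y k ∈ convexHull ℝ (y '' (Icc (b - d - d + 1) (b - d + d - 1) \ {(b:ℤ) - d})) := by
      intro k hk h1 h2
      rw [mem_iff hM hk.1]
      have := hamin k hk
      have := hbmax k hk
      exact ⟨k, by omega, by omega, h2, Or.inl rfl⟩
    by_cases hjV : b - (d:ℤ) ∈ V
    · exact main (b - d) hj b hb (b - d) hjV hnb hin
    · exact main (b - d) hj b hb b hb hnb (fun k hk h1 _ => hin k hk h1 (fun h => hjV (h ▸ hk)))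
  · obtain ⟨j, hjV, hja, hjb⟩ : ∃ j ∈ V, j ≠ a ∧ j ≠ b := by
      by_contra hcon
      push Not at hcon
      have a0 := hcon _ (hkV 0)
      have a1 := hcon _ (hkV 1)
      have a2 := hcon _ (hkV 2)
      omega
    have h1 := hamin j hjV
    have h2 := hbmax j hjV
    refine main j hjV.1 j hjV j hjV ?_ ?_
    · rw [mem_iff hM hjV.1]
      rintro ⟨t, ht⟩; omega
    · intro k hk hkj _
      rw [mem_iff hM hk.1]
      have := hamin k hk
      have := hbmax k hk
      exact ⟨k, by omega, by omega, hkj, Or.inl rfl⟩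

lemma forward {E' : Type*} [NormedAddCommGroup E'] [NormedSpace ℝ E'] {d n : ℕ} 
    {P : Set E} {x : ℤ → E} (hM : IsMultiplex d n P x) {d' n' : ℕ} {Q F : Set E'} {y : ℤ → E'}
    (hQ : IsMultiplex d' n' Q y) (hF : IsFaceOf Q F) (hne : F ≠ Q) (hc : CombEquiv P F) :
    n ≤ 2 * d - 1 := by
  by_contra hcon
  obtain ⟨e⟩ := hc
  have hd := hM.two_le_d
  refine not_prp hM (by omega) (Prp.transfer e.symm (face_prp hQ hF hne ?_))
  have hP := hM.hull
  have hext := hextX hM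
  have hfin := finX x n
  subst hP
  have hi : ∀ i : Fin 3, ((i : ℕ) : ℤ) ∈ Icc (0:ℤ) n := fun i => ⟨by omega, by omega⟩
  refine ⟨fun i => e ⟨{x (i : ℕ)}, vertex_face hfin hext ⟨_, hi i, rfl⟩⟩, ?_, ?_⟩
  · intro i j hij
    have h1 := congrArg Subtype.val (e.injective hij)
    have := hM.inj (hi i) (hi j) (singleton_injective h1)
    exact Fin.ext (by exact_mod_cast this)
  · intro i
    exact e.isMin_apply.2 (isMin_vertex hfin hext ⟨_, hi i, rfl⟩)


section transfer
variable {E' : Type*} [NormedAddCommGroup E'] [NormedSpace ℝ E']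

lemma face_image {P G : Set E} (T : E →L[ℝ] E') (R : E' →L[ℝ] E) (h : ∀ z ∈ P, R (T z) = z)
    (hG : IsFaceOf P G) : IsFaceOf (T '' P) (T '' G) := by
  obtain ⟨hne, l, c, hle, rfl⟩ := face_iff.1 hG
  refine face_iff.2 ⟨hne.image T, l.comp R, c, ?_, ?_⟩
  · rintro _ ⟨z, hz, rfl⟩
    simpa [h z hz] using hle z hz
  · ext w
    constructor
    · rintro ⟨z, ⟨hz, hzc⟩, rfl⟩
      exact ⟨⟨z, hz, rfl⟩, by simpa [h z hz] using hzc⟩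
    · rintro ⟨⟨z, hz, rfl⟩, hzc⟩
      exact ⟨z, ⟨hz, by simpa [h z hz] using hzc⟩, rfl⟩

lemma inv_image {P G : Set E} (T : E →L[ℝ] E') (R : E' →L[ℝ] E) (h : ∀ z ∈ P, R (T z) = z)
    (hG : G ⊆ P) : R '' (T '' G) = G := by
  rw [image_image]
  ext z
  constructor
  · rintro ⟨w, hw, rfl⟩
    simpa [h w (hG hw)] using hw
  · intro hz
    exact ⟨z, hz, h z (hG hz)⟩

lemma combEquiv_image {P : Set E} (T : E →L[ℝ] E') (R : E' →L[ℝ] E)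
    (h : ∀ z ∈ P, R (T z) = z) : CombEquiv P (T '' P) := by
  have h' : ∀ w ∈ T '' P, T (R w) = w := by
    rintro _ ⟨z, hz, rfl⟩; rw [h z hz]
  refine ⟨{ toFun := fun G => ⟨T '' G.1, face_image T R h G.2⟩
            invFun := fun G => ⟨R '' G.1, ?_⟩
            left_inv := ?_
            right_inv := ?_
            map_rel_iff' := ?_ }⟩
  · have := face_image R T h' G.2
    rwa [inv_image T R h subset_rfl] at this
  · intro G
    exact Subtype.ext (inv_image T R h G.2.1.subset)
  · intro G
    exact Subtype.ext (inv_image R T h' G.2.1.subset)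
  · intro G H
    change T '' G.1 ⊆ T '' H.1 ↔ G.1 ⊆ H.1
    constructor
    · intro hs
      have := image_mono (f := R) hs
      rwa [inv_image T R h G.2.1.subset, inv_image T R h H.2.1.subset] at this
    · exact fun hs => image_mono hs

lemma vectorSpan_image (T : E →L[ℝ] E') (G : Set E) :
    vectorSpan ℝ (T '' G) = (vectorSpan ℝ G).map T.toLinearMap := by
  have := AffineMap.map_vectorSpan (k := ℝ) T.toLinearMap.toAffineMap (s := G)
  exact this.symm

lemma pdim_image {P G : Set E} (T : E →L[ℝ] E') (R : E' →L[ℝ] E) (h : ∀ z ∈ P, R (T z) = z)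
    [FiniteDimensional ℝ (vectorSpan ℝ P)] (hG : G ⊆ P) : pdim (T '' G) = pdim G := by
  have hle : vectorSpan ℝ G ≤ vectorSpan ℝ P := vectorSpan_mono ℝ hG
  have : FiniteDimensional ℝ (vectorSpan ℝ G) := Submodule.finiteDimensional_of_le hle
  apply le_antisymm
  · rw [pdim_eq, pdim_eq, vectorSpan_image]
    exact Submodule.finrank_map_le _ _
  · rw [← congrArg pdim (inv_image T R h hG), pdim_eq, pdim_eq, vectorSpan_image R,
      vectorSpan_image T]
    exact Submodule.finrank_map_le _ _

lemma multiplex_image {d n : ℕ} {P : Set E} {x : ℤ → E} (hM : IsMultiplex d n P x)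
    (T : E →L[ℝ] E') (R : E' →L[ℝ] E) (h : ∀ z ∈ P, R (T z) = z) :
    IsMultiplex d n (T '' P) (T ∘ x) := by
  have h' : ∀ w ∈ T '' P, T (R w) = w := by
    rintro _ ⟨z, hz, rfl⟩; rw [h z hz]
  have hXP : ∀ k ∈ Icc (0:ℤ) n, x k ∈ P := fun k hk => by
    rw [hM.hull]; exact subset_convexHull ℝ _ ⟨k, hk, rfl⟩
  have hfd : FiniteDimensional ℝ (vectorSpan ℝ P) := by
    rw [hM.hull]; exact fd_hull (finX x n)
  have hhull : T '' P = convexHull ℝ ((T ∘ x) '' Icc (0:ℤ) n) := by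
    rw [image_comp, hM.hull]
    exact T.toLinearMap.isLinear.image_convexHull _
  refine ⟨hM.two_le_d, hM.d_le_n, ?_, ?_, ?_, hhull, ?_, ?_, ?_⟩
  · intro j hj; simp [hM.clamp_lo j hj]
  · intro j hj; simp [hM.clamp_hi j hj]
  · intro a ha b hb hab
    apply hM.inj ha hb
    have := congrArg R hab
    simpa [h _ (hXP a ha), h _ (hXP b hb)] using this
  · apply subset_antisymm
    · rw [hhull]; exact extremePoints_convexHull_subset
    · rintro _ ⟨k, hk, rfl⟩
      have hv : x k ∈ P.extremePoints ℝ := by rw [hM.verts]; exact ⟨k, hk, rfl⟩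
      rw [mem_extremePoints_iff_left] at hv ⊢
      refine ⟨⟨x k, hv.1, rfl⟩, ?_⟩
      rintro _ ⟨a, ha, rfl⟩ _ ⟨b, hb, rfl⟩ hseg
      have : x k ∈ openSegment ℝ a b := by
        obtain ⟨s, t, hs, ht, hst, he⟩ := hseg
        refine ⟨s, t, hs, ht, hst, ?_⟩
        have := congrArg R he
        simpa [h _ ha, h _ hb, h _ (hXP k hk)] using this
      simp [hv.2 a ha b hb this]
  · rw [pdim_image T R h subset_rfl, hM.dim]
  · intro F
    have himg : ∀ i : ℤ, convexHull ℝ ((T ∘ x) '' (Icc (i - d + 1) (i + d - 1) \ {i})) =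
        T '' convexHull ℝ (x '' (Icc (i - d + 1) (i + d - 1) \ {i})) := by
      intro i
      rw [image_comp]
      exact (T.toLinearMap.isLinear.image_convexHull _).symm
    constructor
    · rintro ⟨hF, hdim⟩
      have hRF := face_image R T h' hF
      rw [inv_image T R h subset_rfl] at hRF
      have hTR : T '' (R '' F) = F := inv_image R T h' hF.1.subset
      have hd : pdim (R '' F) = d - 1 := by
        rw [← pdim_image T R h hRF.1.subset, hTR, hdim]
      obtain ⟨i, hi, he⟩ := (hM.facets _).1 ⟨hRF, hd⟩
      refine ⟨i, hi, ?_⟩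
      rw [himg, ← he, hTR]
    · rintro ⟨i, hi, rfl⟩
      obtain ⟨h1, h2⟩ := (hM.facets _).2 ⟨i, hi, rfl⟩
      rw [himg]
      exact ⟨face_image T R h h1, by rw [pdim_image T R h h1.1.subset, h2]⟩

lemma exists_embedding {X : Set E} (hX : X.Finite) :
    ∃ (N : ℕ) (T : E →L[ℝ] EuclideanSpace ℝ (Fin N)) (R : EuclideanSpace ℝ (Fin N) →L[ℝ] E)
      (h : StrongDual ℝ (EuclideanSpace ℝ (Fin N))) (p : EuclideanSpace ℝ (Fin N)),
      (∀ z ∈ convexHull ℝ X, R (T z) = z) ∧ (∀ z, h (T z) = 0) ∧ h p = 1 := by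
  let S := Submodule.span ℝ X
  have : FiniteDimensional ℝ S := FiniteDimensional.span_of_finite ℝ hX
  obtain ⟨π, hπ⟩ := Submodule.ClosedComplemented.of_finiteDimensional S
  let e := toEuclidean (E := S × ℝ)
  refine ⟨_, (e : (S × ℝ) →L[ℝ] _).comp ((ContinuousLinearMap.inl ℝ S ℝ).comp π),
    S.subtypeL.comp ((ContinuousLinearMap.fst ℝ S ℝ).comp (e.symm : _ →L[ℝ] (S × ℝ))),
    (ContinuousLinearMap.snd ℝ S ℝ).comp (e.symm : _ →L[ℝ] (S × ℝ)), e (0, 1), ?_, ?_, ?_⟩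
  · intro z hz
    have hzS : z ∈ S := convexHull_min Submodule.subset_span S.convex hz
    have := hπ ⟨z, hzS⟩
    simp [this]
  · intro z; simp
  · simp

end transfer


lemma pdim_pyr {F : Set E} {h : StrongDual ℝ E} {p : E} (hF : F.Nonempty)
    [FiniteDimensional ℝ (vectorSpan ℝ F)] (h0 : ∀ z ∈ F, h z = 0) (hp : h p = 1) :
    pdim (convexHull ℝ (insert p F)) = pdim F + 1 := by
  obtain ⟨g, hg⟩ := hF
  have hdir : vectorSpan ℝ (insert p F) = Submodule.span ℝ {p - g} ⊔ vectorSpan ℝ F := by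
    rw [← direction_affineSpan, ← affineSpan_insert_affineSpan,
      AffineSubspace.direction_affineSpan_insert (mem_affineSpan ℝ hg), direction_affineSpan]
    rfl
  rw [pdim_eq, pdim_eq, vectorSpan_hull, hdir]
  have hk := vs_le_ker h h0
  have hpg : h (p - g) = 1 := by simp [hp, h0 g hg]
  have hinf : Submodule.span ℝ {p - g} ⊓ vectorSpan ℝ F = ⊥ := by
    rw [Submodule.eq_bot_iff]
    rintro z ⟨hz1, hz2⟩
    obtain ⟨c, rfl⟩ := Submodule.mem_span_singleton.1 hz1
    have := hk hz2
    have hc : c = 0 := by simpa [hp, h0 g hg] using this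
    simp [hc]
  have := Submodule.finrank_sup_add_finrank_inf_eq (Submodule.span ℝ {p - g}) (vectorSpan ℝ F)
  rw [hinf, finrank_span_singleton (by intro hz; simp [hz] at hpg)] at this
  simp at this
  omega

/-- vertices of the pyramid -/
noncomputable def pyrV (d : ℕ) (x : ℤ → E) (p : E) (k : ℤ) : E :=
  if k < d then x k else if k = d then p else x (k - 1)

lemma pyrV_lt {d : ℕ} {x : ℤ → E} {p : E} {k : ℤ} (h : k < d) : pyrV d x p k = x k := by
  simp [pyrV, h]

lemma pyrV_eq {d : ℕ} {x : ℤ → E} {p : E} : pyrV d x p d = p := by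
  simp [pyrV]

lemma pyrV_gt {d : ℕ} {x : ℤ → E} {p : E} {k : ℤ} (h : (d : ℤ) < k) :
    pyrV d x p k = x (k - 1) := by
  simp [pyrV, h.not_gt, h.ne']

lemma pyrV_image_lt {d n : ℕ} {P : Set E} {x : ℤ → E} (hM : IsMultiplex d n P x) {p : E} {k : ℤ}
    (hk0 : 0 ≤ k) (hkd : k < d) :
    pyrV d x p '' (Icc (k - (d + 1 : ℕ) + 1) (k + (d + 1 : ℕ) - 1) \ {k}) =
      insert p (x '' (Icc (k - d + 1) (k + d - 1) \ {k})) := by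
  have hd := hM.two_le_d
  apply subset_antisymm
  · rintro _ ⟨i, ⟨⟨h1, h2⟩, h3⟩, rfl⟩
    push_cast at h1 h2
    rw [mem_singleton_iff] at h3
    rcases lt_trichotomy i d with h | h | h
    · rw [pyrV_lt h]
      right
      by_cases hi : i = k - d
      · refine ⟨k - d + 1, ⟨⟨by omega, by omega⟩, by rw [mem_singleton_iff]; omega⟩, ?_⟩
        rw [hM.clamp_lo i (by omega), hM.clamp_lo (k - d + 1) (by omega)]
      · exact ⟨i, ⟨⟨by omega, by omega⟩, h3⟩, rfl⟩
    · subst h; rw [pyrV_eq]; left; rfl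
    · rw [pyrV_gt h]
      right
      exact ⟨i - 1, ⟨⟨by omega, by omega⟩, by rw [mem_singleton_iff]; omega⟩, rfl⟩
  · apply insert_subset
    · exact ⟨d, ⟨⟨by push_cast; omega, by push_cast; omega⟩, by rw [mem_singleton_iff]; omega⟩,
        pyrV_eq⟩
    · rintro _ ⟨i, ⟨⟨h1, h2⟩, h3⟩, rfl⟩
      rw [mem_singleton_iff] at h3
      rcases lt_or_ge i d with h | h
      · exact ⟨i, ⟨⟨by push_cast; omega, by push_cast; omega⟩, h3⟩, pyrV_lt h⟩
      · exact ⟨i + 1, ⟨⟨by push_cast; omega, by push_cast; omega⟩, by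
          rw [mem_singleton_iff]; omega⟩, by rw [pyrV_gt (by omega)]; simp⟩

lemma pyrV_image_gt {d n : ℕ} {P : Set E} {x : ℤ → E} (hM : IsMultiplex d n P x)
    (hn : n ≤ 2 * d - 1) {p : E} {k : ℤ} (hkn : k ≤ n + 1) (hkd : d < k) :
    pyrV d x p '' (Icc (k - (d + 1 : ℕ) + 1) (k + (d + 1 : ℕ) - 1) \ {k}) =
      insert p (x '' (Icc (k - 1 - d + 1) (k - 1 + d - 1) \ {k - 1})) := by
  have hd := hM.two_le_d
  apply subset_antisymm
  · rintro _ ⟨i, ⟨⟨h1, h2⟩, h3⟩, rfl⟩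
    push_cast at h1 h2
    rw [mem_singleton_iff] at h3
    rcases lt_trichotomy i d with h | h | h
    · rw [pyrV_lt h]
      right
      exact ⟨i, ⟨⟨by omega, by omega⟩, by rw [mem_singleton_iff]; omega⟩, rfl⟩
    · subst h; rw [pyrV_eq]; left; rfl
    · rw [pyrV_gt h]
      right
      by_cases hi : i = k + d
      · refine ⟨k - 1 + d - 1, ⟨⟨by omega, by omega⟩, by rw [mem_singleton_iff]; omega⟩, ?_⟩
        rw [hM.clamp_hi (i - 1) (by omega), hM.clamp_hi (k - 1 + d - 1) (by omega)]
      · exact ⟨i - 1, ⟨⟨by omega, by omega⟩, by rw [mem_singleton_iff]; omega⟩, rfl⟩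
  · apply insert_subset
    · exact ⟨d, ⟨⟨by push_cast; omega, by push_cast; omega⟩, by rw [mem_singleton_iff]; omega⟩,
        pyrV_eq⟩
    · rintro _ ⟨i, ⟨⟨h1, h2⟩, h3⟩, rfl⟩
      rw [mem_singleton_iff] at h3
      rcases lt_or_ge i d with h | h
      · exact ⟨i, ⟨⟨by push_cast; omega, by push_cast; omega⟩, by
          rw [mem_singleton_iff]; omega⟩, pyrV_lt h⟩
      · exact ⟨i + 1, ⟨⟨by push_cast; omega, by push_cast; omega⟩, by
          rw [mem_singleton_iff]; omega⟩, by rw [pyrV_gt (by omega)]; simp⟩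

lemma pyrV_image_eq {d n : ℕ} {P : Set E} {x : ℤ → E} (hM : IsMultiplex d n P x)
    (hn : n ≤ 2 * d - 1) {p : E} :
    pyrV d x p '' (Icc ((d:ℤ) - (d + 1 : ℕ) + 1) (d + (d + 1 : ℕ) - 1) \ {(d:ℤ)}) =
      x '' Icc (0:ℤ) n := by
  have hd := hM.two_le_d
  have hdn := hM.d_le_n
  apply subset_antisymm
  · rintro _ ⟨i, ⟨⟨h1, h2⟩, h3⟩, rfl⟩
    push_cast at h1 h2
    rw [mem_singleton_iff] at h3
    rcases lt_trichotomy i d with h | h | h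
    · rw [pyrV_lt h]
      exact ⟨i, ⟨by omega, by omega⟩, rfl⟩
    · exact absurd h h3
    · rw [pyrV_gt h]
      rcases le_total (i - 1) n with h' | h'
      · exact ⟨i - 1, ⟨by omega, h'⟩, rfl⟩
      · rw [hM.clamp_hi _ h']; exact ⟨n, ⟨by omega, le_rfl⟩, rfl⟩
  · rintro _ ⟨i, ⟨h1, h2⟩, rfl⟩
    rcases lt_or_ge i d with h | h
    · exact ⟨i, ⟨⟨by push_cast; omega, by push_cast; omega⟩, by
        rw [mem_singleton_iff]; omega⟩, pyrV_lt h⟩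
    · exact ⟨i + 1, ⟨⟨by push_cast; omega, by push_cast; omega⟩, by
        rw [mem_singleton_iff]; omega⟩, by rw [pyrV_gt (by omega)]; simp⟩

lemma pyrV_image_all {d n : ℕ} {P : Set E} {x : ℤ → E} (hM : IsMultiplex d n P x) {p : E} :
    pyrV d x p '' Icc (0:ℤ) (n + 1 : ℕ) = insert p (x '' Icc (0:ℤ) n) := by
  have hd := hM.two_le_d
  have hdn := hM.d_le_n
  apply subset_antisymm
  · rintro _ ⟨i, ⟨h1, h2⟩, rfl⟩
    push_cast at h2
    rcases lt_trichotomy i d with h | h | h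
    · rw [pyrV_lt h]
      right
      exact ⟨i, ⟨by omega, by omega⟩, rfl⟩
    · subst h; rw [pyrV_eq]; left; rfl
    · rw [pyrV_gt h]
      right
      exact ⟨i - 1, ⟨by omega, by omega⟩, rfl⟩
  · apply insert_subset
    · exact ⟨d, ⟨by omega, by push_cast; omega⟩, pyrV_eq⟩
    · rintro _ ⟨i, ⟨h1, h2⟩, rfl⟩
      rcases lt_or_ge i d with h | h
      · exact ⟨i, ⟨by omega, by push_cast; omega⟩, pyrV_lt h⟩
      · exact ⟨i + 1, ⟨by omega, by push_cast; omega⟩, by rw [pyrV_gt (by omega)]; simp⟩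

lemma hull_insert_hull (p : E) (S : Set E) :
    convexHull ℝ (insert p (convexHull ℝ S)) = convexHull ℝ (insert p S) := by
  apply subset_antisymm
  · refine convexHull_min (insert_subset (subset_convexHull ℝ _ (mem_insert _ _)) ?_)
      (convex_convexHull ℝ _)
    exact convexHull_mono (subset_insert _ _)
  · exact convexHull_mono (insert_subset_insert (subset_convexHull ℝ S))

lemma base_face {X : Set E} (hX : X.Finite) (hne : X.Nonempty) {h : StrongDual ℝ E} {p : E}
    (h0 : ∀ z ∈ X, h z = 0) (hp : h p = 1) :
    IsFaceOf (convexHull ℝ (insert p X)) (convexHull ℝ X) := by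
  have hf : IsFaceOf (convexHull ℝ (insert p X))
      {z ∈ convexHull ℝ (insert p X) | (-h) z = 0} := by
    refine face_iff.2 ⟨?_, -h, 0, ?_, rfl⟩
    · obtain ⟨v, hv⟩ := hne
      exact ⟨v, subset_convexHull ℝ _ (mem_insert_of_mem _ hv), by simp [h0 v hv]⟩
    · apply le_on_hull
      rintro z (rfl | hz)
      · simp [hp]
      · simp [h0 z hz]
  have he := face_eq_hull (hX.insert p) hf.1
  have : insert p X ∩ {z ∈ convexHull ℝ (insert p X) | (-h) z = 0} = X := by
    ext z
    constructor
    · rintro ⟨rfl | hz, _, h2⟩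
      · simp [hp] at h2
      · exact hz
    · intro hz
      exact ⟨mem_insert_of_mem _ hz, subset_convexHull ℝ _ (mem_insert_of_mem _ hz),
        by simp [h0 z hz]⟩
  rw [this] at he
  rwa [he] at hf

lemma pyr_face {X F : Set E} (hX : X.Finite) {h : StrongDual ℝ E} {p : E}
    (h0 : ∀ z ∈ X, h z = 0) (hp : h p = 1) (hF : IsFaceOf (convexHull ℝ X) F) :
    IsFaceOf (convexHull ℝ (insert p X)) (convexHull ℝ (insert p F)) := by
  obtain ⟨hne, l, c, hle, hFe⟩ := face_iff.1 hF
  have hFX := face_eq_hull hX hF.1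
  set l' : StrongDual ℝ E := l + (c - l p) • h with hl'
  have hlX : ∀ z ∈ X, l' z = l z := fun z hz => by simp [hl', h0 z hz]
  have hlp : l' p = c := by simp [hl', hp]
  have hf : IsFaceOf (convexHull ℝ (insert p X))
      {z ∈ convexHull ℝ (insert p X) | l' z = c} := by
    refine face_iff.2 ⟨⟨p, subset_convexHull ℝ _ (mem_insert _ _), hlp⟩, l', c, ?_, rfl⟩
    apply le_on_hull
    rintro z (rfl | hz)
    · exact hlp.le
    · rw [hlX z hz]; exact hle z (subset_convexHull ℝ _ hz)
  have he := face_eq_hull (hX.insert p) hf.1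
  have : insert p X ∩ {z ∈ convexHull ℝ (insert p X) | l' z = c} = insert p (X ∩ F) := by
    ext z
    constructor
    · rintro ⟨rfl | hz, _, h2⟩
      · left; rfl
      · right
        refine ⟨hz, ?_⟩
        rw [hFe]
        exact ⟨subset_convexHull ℝ _ hz, by rw [← hlX z hz, h2]⟩
    · rintro (rfl | ⟨hz, hzF⟩)
      · exact ⟨mem_insert _ _, subset_convexHull ℝ _ (mem_insert _ _), hlp⟩
      · rw [hFe] at hzF
        exact ⟨mem_insert_of_mem _ hz, subset_convexHull ℝ _ (mem_insert_of_mem _ hz),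
          by rw [hlX z hz]; exact hzF.2⟩
  rw [this, ← hull_insert_hull p (X ∩ F), ← hFX] at he
  rwa [he] at hf

lemma pyramid {d n : ℕ} {P : Set E} {x : ℤ → E} (hM : IsMultiplex d n P x)
    (hn : n ≤ 2 * d - 1) {h : StrongDual ℝ E} {p : E} (h0 : ∀ z ∈ P, h z = 0) (hp : h p = 1) :
    IsMultiplex (d + 1) (n + 1) (convexHull ℝ (insert p (x '' Icc (0:ℤ) n))) (pyrV d x p) := by
  have hd := hM.two_le_d
  have hdn := hM.d_le_n
  set X := x '' Icc (0:ℤ) n with hXdef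
  have hPX : P = convexHull ℝ X := hM.hull
  have hfin : X.Finite := finX x n
  have hXP : X ⊆ P := by rw [hPX]; exact subset_convexHull ℝ _
  have h0X : ∀ z ∈ X, h z = 0 := fun z hz => h0 z (hXP hz)
  have hXne : X.Nonempty := ⟨x 0, 0, by simp, rfl⟩
  have hPne : P.Nonempty := hXne.mono hXP
  have hfd : FiniteDimensional ℝ (vectorSpan ℝ P) := by rw [hPX]; exact fd_hull hfin
  have hbase : IsFaceOf (convexHull ℝ (insert p X)) P := by
    rw [hPX]; exact base_face hfin hXne h0X hp
  have hxX : ∀ t, x t ∈ X := by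
    intro t
    rcases le_total t 0 with h | h
    · rw [hM.clamp_lo t h]; exact ⟨0, by simp, rfl⟩
    rcases le_total t n with h' | h'
    · exact ⟨t, ⟨h, h'⟩, rfl⟩
    · rw [hM.clamp_hi t h']; exact ⟨n, by simp, rfl⟩
  have hpx : ∀ t, x t ≠ p := fun t ht => by
    have := h0X _ (hxX t)
    rw [ht, hp] at this
    exact one_ne_zero this
  have hdimQ : pdim (convexHull ℝ (insert p X)) = d + 1 := by
    rw [← hull_insert_hull, ← hPX, pdim_pyr hPne h0 hp, hM.dim]
  have hPp : pdim P = d := hM.dim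
  refine ⟨by omega, by omega, ?_, ?_, ?_, ?_, ?_, hdimQ, ?_⟩
  · intro j hj
    rw [pyrV_lt (by omega), pyrV_lt (by omega), hM.clamp_lo j hj]
  · intro j hj
    push_cast at hj
    rw [pyrV_gt (by omega), pyrV_gt (by push_cast; omega), hM.clamp_hi (j - 1) (by omega),
      hM.clamp_hi (((n + 1 : ℕ) : ℤ) - 1) (by push_cast; omega)]
  · rintro a ⟨ha0, ha1⟩ b ⟨hb0, hb1⟩ hab
    push_cast at ha1 hb1
    rcases lt_trichotomy a d with h1 | h1 | h1 <;> rcases lt_trichotomy b d with h2 | h2 | h2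
    · rw [pyrV_lt h1, pyrV_lt h2] at hab
      exact hM.inj ⟨ha0, by omega⟩ ⟨hb0, by omega⟩ hab
    · subst h2; rw [pyrV_lt h1, pyrV_eq] at hab; exact absurd hab (hpx _)
    · rw [pyrV_lt h1, pyrV_gt h2] at hab
      have := hM.inj ⟨ha0, by omega⟩ ⟨by omega, by omega⟩ hab
      omega
    · subst h1; rw [pyrV_lt h2, pyrV_eq] at hab; exact absurd hab.symm (hpx _)
    · omega
    · subst h1; rw [pyrV_gt h2, pyrV_eq] at hab; exact absurd hab.symm (hpx _)
    · rw [pyrV_gt h1, pyrV_lt h2] at hab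
      have := hM.inj ⟨by omega, by omega⟩ ⟨by omega, by omega⟩ hab
      omega
    · subst h2; rw [pyrV_gt h1, pyrV_eq] at hab; exact absurd hab (hpx _)
    · rw [pyrV_gt h1, pyrV_gt h2] at hab
      have := hM.inj ⟨by omega, by omega⟩ ⟨by omega, by omega⟩ hab
      omega
  · rw [pyrV_image_all hM]
  · rw [pyrV_image_all hM]
    apply subset_antisymm extremePoints_convexHull_subset
    apply insert_subset
    · have hf : IsFaceOf (convexHull ℝ (insert p X))
          {z ∈ convexHull ℝ (insert p X) | h z = 1} := by
        refine face_iff.2 ⟨⟨p, subset_convexHull ℝ _ (mem_insert _ _), hp⟩, h, 1, ?_, rfl⟩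
        apply le_on_hull
        rintro z (rfl | hz)
        · exact hp.le
        · simp [h0X z hz]
      have he := face_eq_hull (hfin.insert p) hf.1
      have : insert p X ∩ {z ∈ convexHull ℝ (insert p X) | h z = 1} = {p} := by
        ext z
        constructor
        · rintro ⟨rfl | hz, _, h2⟩
          · rfl
          · simp [h0X z hz] at h2
        · rintro rfl
          exact ⟨mem_insert _ _, subset_convexHull ℝ _ (mem_insert _ _), hp⟩
      rw [this, convexHull_singleton] at he
      rw [he] at hf
      exact isExtreme_singleton.1 hf.1.isExtreme
    · have := hbase.1.isExtreme.extremePoints_subset_extremePoints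
      rwa [hM.verts] at this
  · intro G
    have hpyr : ∀ i : ℤ, i ∈ Icc (0:ℤ) n →
        IsFaceOf (convexHull ℝ (insert p X))
          (convexHull ℝ (insert p (x '' (Icc (i - d + 1) (i + d - 1) \ {i})))) ∧
        pdim (convexHull ℝ (insert p (x '' (Icc (i - d + 1) (i + d - 1) \ {i})))) = d := by
      intro i hi
      obtain ⟨h1, h2⟩ := (hM.facets _).2 ⟨i, hi, rfl⟩
      set F := convexHull ℝ (x '' (Icc (i - d + 1) (i + d - 1) \ {i})) with hFdef
      rw [← hull_insert_hull p (x '' (Icc (i - d + 1) (i + d - 1) \ {i})), ← hFdef]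
      have : FiniteDimensional ℝ (vectorSpan ℝ F) :=
        Submodule.finiteDimensional_of_le (vectorSpan_mono ℝ h1.1.subset)
      refine ⟨pyr_face hfin h0X hp (hPX ▸ h1), ?_⟩
      rw [pdim_pyr h1.2 (fun z hz => h0 z (h1.1.subset hz)) hp, h2]
      omega
    constructor
    · rintro ⟨hG, hGd⟩
      rw [Nat.add_sub_cancel] at hGd
      have hGX := face_eq_hull (hfin.insert p) hG.1
      by_cases hpG : p ∈ G
      · have hins : insert p X ∩ G = insert p (X ∩ G) := insert_inter_of_mem hpG
        rw [hins] at hGX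
        rcases (X ∩ G).eq_empty_or_nonempty with he | hne
        · exfalso
          rw [he] at hGX
          simp only [insert_empty_eq, convexHull_singleton] at hGX
          rw [hGX, pdim_eq, vectorSpan_singleton] at hGd
          simp at hGd
          omega
        · have hF : IsFaceOf P (G ∩ P) :=
            ⟨(hG.1.inter hbase.1).mono hbase.1.subset inter_subset_right,
              hne.mono (fun z hz => ⟨hz.2, hXP hz.1⟩)⟩
          have hFX : G ∩ P = convexHull ℝ (X ∩ G) := by
            have := face_eq_hull hfin (hPX ▸ hF.1)
            rw [← hPX] at this
            rw [this]
            congr 1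
            ext z
            exact ⟨fun hz => ⟨hz.1, hz.2.1⟩, fun hz => ⟨hz.1, hz.2, hXP hz.1⟩⟩
          have : FiniteDimensional ℝ (vectorSpan ℝ (G ∩ P)) :=
            Submodule.finiteDimensional_of_le (vectorSpan_mono ℝ inter_subset_right)
          have hGF : G = convexHull ℝ (insert p (G ∩ P)) := by
            rw [hFX, hull_insert_hull]; exact hGX
          have hdimF : pdim (G ∩ P) = d - 1 := by
            have := pdim_pyr hF.2 (fun z hz => h0 z hz.2) hp
            rw [← hGF] at this
            omega
          obtain ⟨i, ⟨hi0, hin⟩, hFi⟩ := (hM.facets _).1 ⟨hF, hdimF⟩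
          rw [hFi, hull_insert_hull] at hGF
          rcases lt_or_ge i d with hid | hid
          · refine ⟨i, ⟨hi0, by push_cast; omega⟩, ?_⟩
            rw [pyrV_image_lt hM hi0 hid]
            exact hGF
          · refine ⟨i + 1, ⟨by omega, by push_cast; omega⟩, ?_⟩
            rw [pyrV_image_gt hM hn (by omega) (by omega), add_sub_cancel_right]
            exact hGF
      · have hins : insert p X ∩ G = X ∩ G := insert_inter_of_notMem hpG
        rw [hins] at hGX
        have hGP : G ⊆ P := by
          rw [hGX, hPX]; exact convexHull_mono inter_subset_left
        have hGf : IsFaceOf P G := ⟨hG.1.mono hbase.1.subset hGP, hG.2⟩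
        have hGe : G = P := by
          by_contra hne
          have := pdim_lt hGf hne
          omega
        refine ⟨d, ⟨by omega, by push_cast; omega⟩, ?_⟩
        rw [pyrV_image_eq hM hn, hGe, hPX]
    · rintro ⟨k, ⟨hk0, hkn⟩, rfl⟩
      push_cast at hkn
      rw [Nat.add_sub_cancel]
      rcases lt_trichotomy k d with hk | hk | hk
      · rw [pyrV_image_lt hM hk0 hk]
        exact hpyr k ⟨hk0, by omega⟩
      · subst hk
        rw [pyrV_image_eq hM hn, ← hXdef, ← hPX]
        exact ⟨hbase, hPp⟩
      · rw [pyrV_image_gt hM hn hkn hk]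
        exact hpyr (k - 1) ⟨by omega, by omega⟩

end MPX

/-- The multiplex `M^{d,n}` is combinatorially isomorphic to a proper face of some
multiplex if and only if `d ≤ n ≤ 2d - 1`. -/
theorem multiplex_is_face_iff (d n : ℕ) (hd : 2 ≤ d) (hdn : d ≤ n)
    (P : Set E) (x : ℤ → E) (hM : IsMultiplex d n P x) :
    (∃ (N d' n' : ℕ) (Q F : Set (EuclideanSpace ℝ (Fin N)))
        (y : ℤ → EuclideanSpace ℝ (Fin N)),
      IsMultiplex d' n' Q y ∧ IsFaceOf Q F ∧ F ≠ Q ∧ CombEquiv P F) ↔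
    n ≤ 2 * d - 1 := by
  constructor
  · rintro ⟨N, d', n', Q, F, y, hQ, hF, hne, hc⟩
    exact MPX.forward hM hQ hF hne hc
  · intro hn
    obtain ⟨N, T, R, h, p, hRT, hT, hp⟩ := MPX.exists_embedding (MPX.finX x n)
    rw [← hM.hull] at hRT
    have hM' := MPX.multiplex_image hM T R hRT
    have h0 : ∀ z ∈ T '' P, h z = 0 := by
      rintro _ ⟨z, _, rfl⟩
      exact hT z
    have hpyr := MPX.pyramid hM' hn h0 hp
    refine ⟨N, d + 1, n + 1, _, T '' P, _, hpyr, ?_, ?_, MPX.combEquiv_image T R hRT⟩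
    · rw [hM'.hull]
      refine MPX.base_face (MPX.finX _ n) ⟨_, 0, by simp, rfl⟩ ?_ hp
      rintro _ ⟨k, _, rfl⟩
      exact hT _
    · intro heq
      have hpQ : p ∈ T '' P := by
        rw [heq]
        exact subset_convexHull ℝ _ (mem_insert _ _)
      have := h0 p hpQ
      rw [hp] at this
      exact one_ne_zero this
end

section
/- In the graph G^{d,n} of the multiplex M^{d,n}, every complete subgraph is the graph of a face of M^{d,n}; in particular, every set of vertices that is pairwise adjacent spans a simplex face. -/
open Set

variable {E : Type*} [NormedAddCommGroup E] [NormedSpace ℝ E]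

/-- Continuous functionals separate points from finite-dimensional subspaces. -/
lemma mpx_exists_functional (V : Submodule ℝ E) [FiniteDimensional ℝ V] (v : E) (hv : v ∉ V) :
    ∃ g : StrongDual ℝ E, (∀ a ∈ V, g a = 0) ∧ g v < 0 := by
  obtain ⟨f, u, h1, h2⟩ := geometric_hahn_banach_closed_point (s := (V : Set E)) (x := v)
    V.convex V.closed_of_finiteDimensional hv
  have h0 : 0 < u := by simpa using h1 0 V.zero_mem
  have hz : ∀ a ∈ V, f a = 0 := by
    intro a ha
    by_contra hne
    have h3 := h1 (((u + 1) / f a) • a) (V.smul_mem _ ha)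
    rw [map_smul, smul_eq_mul, div_mul_cancel₀ _ hne] at h3
    linarith
  refine ⟨-f, ?_, ?_⟩
  · intro a ha
    simp [hz a ha]
  · have : 0 < f v := by linarith
    simpa using this

lemma mpx_const_on_vectorSpan (l : StrongDual ℝ E) (Z : Set E) (c : ℝ) (h : ∀ z ∈ Z, l z = c) :
    ∀ v ∈ vectorSpan ℝ Z, l v = 0 := by
  have : vectorSpan ℝ Z ≤ LinearMap.ker (l : E →ₗ[ℝ] ℝ) := by
    rw [vectorSpan_def, Submodule.span_le]
    rintro _ ⟨a, ha, b, hb, rfl⟩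
    simp [h a ha, h b hb]
  intro v hv
  simpa using this hv

/-- Rotation of a supporting hyperplane. -/
lemma mpx_rotate (S : Finset E) (l g : StrongDual ℝ E) (c : ℝ) (q w : E) (hw : w ∈ S)
    (hl : ∀ s ∈ S, c ≤ l s) (hg : ∀ s ∈ S, l s = c → g (s - q) = 0) (hgw : g (w - q) < 0) :
    ∃ l' : StrongDual ℝ E, ∃ c' : ℝ, (∀ s ∈ S, c' ≤ l' s) ∧
      (∀ s ∈ S, g (s - q) = 0 → l' s - c' = l s - c) ∧
      ∃ s ∈ S, g (s - q) ≠ 0 ∧ l' s = c' := by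
  classical
  obtain ⟨m, hm, hmin⟩ := (S.filter (fun s => g (s - q) < 0)).exists_min_image
    (fun s => (l s - c) / (-(g (s - q)))) ⟨w, Finset.mem_filter.mpr ⟨hw, hgw⟩⟩
  rw [Finset.mem_filter] at hm
  set t := (l m - c) / (-(g (m - q))) with ht
  have ht0 : 0 ≤ t := div_nonneg (by linarith [hl m hm.1]) (by linarith [hm.2])
  have key : ∀ s, (l + t • g) s - (c + t * g q) = l s - c + t * g (s - q) := by
    intro s
    simp [map_sub]
    ring
  refine ⟨l + t • g, c + t * g q, ?_, ?_, m, hm.1, hm.2.ne, ?_⟩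
  · intro s hs
    have := key s
    suffices 0 ≤ l s - c + t * g (s - q) by linarith
    by_cases hneg : g (s - q) < 0
    · have h1 := hmin s (Finset.mem_filter.mpr ⟨hs, hneg⟩)
      change t ≤ _ at h1
      rw [le_div_iff₀ (by linarith)] at h1
      linarith
    · have := mul_nonneg ht0 (not_lt.mp hneg)
      linarith [hl s hs]
  · intro s hs h0
    rw [key, h0]
    ring
  · have := key m
    have h2 : t * (-(g (m - q))) = l m - c := div_mul_cancel₀ _ (by linarith [hm.2])
    linarith

/-- Every proper face avoiding `p` extends to a facet avoiding `p`. -/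
lemma mpx_climb (S : Finset E) (p q : E) (hp : p ∈ S) (hq : q ∈ S) :
    ∀ (k : ℕ) (l : StrongDual ℝ E) (c : ℝ), (∀ s ∈ S, c ≤ l s) → l q = c → c < l p →
      Module.finrank ℝ (vectorSpan ℝ (S : Set E)) ≤
        Module.finrank ℝ (vectorSpan ℝ {s : E | s ∈ S ∧ l s = c}) + k →
      ∃ l' : StrongDual ℝ E, ∃ c' : ℝ, (∀ s ∈ S, c' ≤ l' s) ∧ (∀ s ∈ S, l s = c → l' s = c') ∧
        c' < l' p ∧ Module.finrank ℝ (vectorSpan ℝ {s : E | s ∈ S ∧ l' s = c'}) + 1 =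
          Module.finrank ℝ (vectorSpan ℝ (S : Set E)) := by
  have hSf : (S : Set E).Finite := S.finite_toSet
  haveI : FiniteDimensional ℝ (vectorSpan ℝ (S : Set E)) :=
    finiteDimensional_vectorSpan_of_finite ℝ hSf
  intro k
  induction k with
  | zero =>
    intro l c hl hlq hlp hk
    exfalso
    have hlt : vectorSpan ℝ {s : E | s ∈ S ∧ l s = c} < vectorSpan ℝ (S : Set E) := by
      refine lt_of_le_of_ne (vectorSpan_mono ℝ fun s hs => hs.1) ?_
      intro heq
      have h1 : p - q ∈ vectorSpan ℝ (S : Set E) := vsub_mem_vectorSpan ℝ hp hq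
      rw [← heq] at h1
      have := mpx_const_on_vectorSpan l _ c (fun z hz => hz.2) _ h1
      rw [map_sub] at this
      linarith
    have := Submodule.finrank_lt_finrank_of_lt hlt
    omega
  | succ k ih =>
    intro l c hl hlq hlp hk
    set Z := {s : E | s ∈ S ∧ l s = c} with hZ
    have hZS : Z ⊆ (S : Set E) := fun s hs => hs.1
    have hqZ : q ∈ Z := ⟨hq, hlq⟩
    have hlt : vectorSpan ℝ Z < vectorSpan ℝ (S : Set E) := by
      refine lt_of_le_of_ne (vectorSpan_mono ℝ hZS) ?_
      intro heq
      have h1 : p - q ∈ vectorSpan ℝ (S : Set E) := vsub_mem_vectorSpan ℝ hp hq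
      rw [← heq] at h1
      have := mpx_const_on_vectorSpan l _ c (fun z hz => hz.2) _ h1
      rw [map_sub] at this
      linarith
    have hlt' := Submodule.finrank_lt_finrank_of_lt hlt
    have hif : (insert p Z).Finite := (hSf.subset hZS).insert p
    haveI : FiniteDimensional ℝ (vectorSpan ℝ (insert p Z)) :=
      finiteDimensional_vectorSpan_of_finite ℝ hif
    by_cases hall : ∀ s ∈ S, s - q ∈ vectorSpan ℝ (insert p Z)
    · refine ⟨l, c, hl, fun _ _ h => h, hlp, ?_⟩
      have h1 : vectorSpan ℝ (S : Set E) ≤ vectorSpan ℝ (insert p Z) := by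
        rw [vectorSpan_eq_span_vsub_set_right ℝ (show q ∈ (S : Set E) from hq), Submodule.span_le]
        rintro _ ⟨s, hs, rfl⟩
        exact hall s hs
      have h2 := Submodule.finrank_mono h1
      have h3 := finrank_vectorSpan_insert_le_set ℝ Z p
      rw [← hZ]
      omega
    · push Not at hall
      obtain ⟨w, hw, hwn⟩ := hall
      obtain ⟨g, hg0, hgw⟩ := mpx_exists_functional _ _ hwn
      have hgZ : ∀ s ∈ Z, g (s - q) = 0 := fun s hs =>
        hg0 _ (vsub_mem_vectorSpan ℝ (mem_insert_of_mem _ hs) (mem_insert_of_mem _ hqZ))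
      obtain ⟨l', c', h1, h2, m, hm, hgm, hlm⟩ := mpx_rotate S l g c q w hw hl
        (fun s hs h => hgZ s ⟨hs, h⟩) hgw
      have hgp : g (p - q) = 0 :=
        hg0 _ (vsub_mem_vectorSpan ℝ (mem_insert _ _) (mem_insert_of_mem _ hqZ))
      have hp' := h2 p hp hgp
      have hZ' : ∀ s ∈ S, l s = c → l' s = c' := by
        intro s hs h
        have := h2 s hs (hgZ s ⟨hs, h⟩)
        linarith
      have hlt2 : vectorSpan ℝ Z < vectorSpan ℝ {s : E | s ∈ S ∧ l' s = c'} := by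
        refine lt_of_le_of_ne (vectorSpan_mono ℝ fun s hs => ⟨hs.1, hZ' s hs.1 hs.2⟩) ?_
        intro heq
        have h3 : m - q ∈ vectorSpan ℝ {s : E | s ∈ S ∧ l' s = c'} :=
          vsub_mem_vectorSpan ℝ ⟨hm, hlm⟩ ⟨hq, hZ' q hq hlq⟩
        rw [← heq] at h3
        exact hgm (hg0 _ (vectorSpan_mono ℝ (subset_insert _ _) h3))
      haveI : FiniteDimensional ℝ (vectorSpan ℝ {s : E | s ∈ S ∧ l' s = c'}) :=
        finiteDimensional_vectorSpan_of_finite ℝ (hSf.subset fun s hs => hs.1)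
      have hlt3 := Submodule.finrank_lt_finrank_of_lt hlt2
      obtain ⟨l2, c2, a1, a2, a3, a4⟩ := ih l' c' h1 (hZ' q hq hlq) (by linarith) (by omega)
      exact ⟨l2, c2, a1, fun s hs h => a2 s hs (hZ' s hs h), a3, a4⟩

/-- The face of a convex hull cut out by a functional. -/
lemma mpx_face_eq (S : Set E) (l : StrongDual ℝ E) (c : ℝ) (hl : ∀ s ∈ S, c ≤ l s) :
    {y ∈ convexHull ℝ S | l y = c} = convexHull ℝ {s : E | s ∈ S ∧ l s = c} := by
  apply Subset.antisymm
  · rintro y ⟨hy, hyc⟩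
    obtain ⟨ι, t, w, z, hw0, hw1, hz, rfl⟩ := (convexHull_eq S).subset hy
    rw [Finset.centerMass_eq_of_sum_1 _ _ hw1] at hyc ⊢
    have hsum : ∑ i ∈ t, w i * (l (z i) - c) = 0 := by
      rw [map_sum] at hyc
      simp only [map_smul, smul_eq_mul] at hyc
      simp only [mul_sub, Finset.sum_sub_distrib, ← Finset.sum_mul, hw1, hyc]
      ring
    have h0 := (Finset.sum_eq_zero_iff_of_nonneg (fun i hi =>
      mul_nonneg (hw0 i hi) (sub_nonneg.mpr (hl _ (hz i hi))))).mp hsum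
    classical
    rw [← Finset.sum_filter_of_ne (p := fun i => w i ≠ 0)
      (fun i _ h h' => h (by rw [h', zero_smul]))]
    apply (convex_convexHull ℝ _).sum_mem
    · intro i hi
      exact hw0 i (Finset.mem_filter.mp hi).1
    · rw [Finset.sum_filter_ne_zero, hw1]
    · intro i hi
      obtain ⟨hi, hne⟩ := Finset.mem_filter.mp hi
      apply subset_convexHull
      refine ⟨hz i hi, ?_⟩
      have := (mul_eq_zero.mp (h0 i hi)).resolve_left hne
      linarith
  · apply convexHull_min
    · rintro s ⟨hs, hc⟩
      exact ⟨subset_convexHull ℝ _ hs, hc⟩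
    · exact (convex_convexHull ℝ S).inter (convex_hyperplane l.toLinearMap.isLinear c)

lemma mpx_hull_le (S : Set E) (l : StrongDual ℝ E) (c : ℝ) (hl : ∀ s ∈ S, c ≤ l s) :
    ∀ y ∈ convexHull ℝ S, c ≤ l y := by
  intro y hy
  exact convexHull_min (t := {y | c ≤ l y}) (fun s hs => hl s hs)
    (convex_halfSpace_ge l.toLinearMap.isLinear c) hy

lemma mpx_exposed (S : Set E) (l : StrongDual ℝ E) (c : ℝ) (hl : ∀ s ∈ S, c ≤ l s)
    (q : E) (hq : q ∈ S) (hqc : l q = c) :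
    IsFaceOf (convexHull ℝ S) (convexHull ℝ {s : E | s ∈ S ∧ l s = c}) := by
  refine ⟨fun _ => ⟨-l, ?_⟩, ⟨q, subset_convexHull ℝ _ ⟨hq, hqc⟩⟩⟩
  rw [← mpx_face_eq S l c hl]
  have hle := mpx_hull_le S l c hl
  ext y
  constructor
  · rintro ⟨hy, hyc⟩
    refine ⟨hy, fun z hz => ?_⟩
    have := hle z hz
    simp only [ContinuousLinearMap.neg_apply]
    linarith
  · rintro ⟨hy, hyc⟩
    refine ⟨hy, ?_⟩
    have h1 := hyc q (subset_convexHull ℝ _ hq)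
    have h2 := hle y hy
    simp only [ContinuousLinearMap.neg_apply] at h1
    linarith

lemma mpx_of_face (P F : Set E) (h : IsFaceOf P F) :
    ∃ l : StrongDual ℝ E, ∃ c : ℝ, (∀ y ∈ P, c ≤ l y) ∧ (∀ y ∈ P, y ∈ F ↔ l y = c) := by
  obtain ⟨h1, q, hq⟩ := h
  obtain ⟨l, rfl⟩ := h1 ⟨q, hq⟩
  refine ⟨-l, -(l q), ?_, ?_⟩
  · intro y hy
    simpa using hq.2 y hy
  · intro y hy
    simp only [ContinuousLinearMap.neg_apply, neg_inj]
    constructor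
    · intro hy'
      exact le_antisymm (hq.2 y hy) (hy'.2 q hq.1)
    · intro he
      exact ⟨hy, fun z hz => he ▸ hq.2 z hz⟩

/-- The index set of the vertices of the `m`-th facet. -/
def mpxV (d n : ℕ) (m i : ℤ) : Prop :=
  (m - d + 1 ≤ i ∧ i ≤ m + d - 1 ∧ i ≠ m) ∨ (i = 0 ∧ m - d + 1 ≤ 0) ∨ (i = n ∧ (n : ℤ) ≤ m + d - 1)

section
variable {d n : ℕ} {P : Set E} {x : ℤ → E}

lemma mpx_mem_hull_iff (hM : IsMultiplex d n P x) (T : Set ℤ)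
    (hT : x '' T ⊆ x '' Icc (0:ℤ) n) (i : ℤ) (hi : i ∈ Icc (0:ℤ) n) :
    x i ∈ convexHull ℝ (x '' T) ↔ x i ∈ x '' T := by
  refine ⟨fun h => ?_, fun h => subset_convexHull ℝ _ h⟩
  have hext : x i ∈ P.extremePoints ℝ := by
    rw [hM.verts]
    exact mem_image_of_mem x hi
  have hsub : convexHull ℝ (x '' T) ⊆ P := by
    rw [hM.hull]
    exact convexHull_mono hT
  exact extremePoints_convexHull_subset
    (inter_extremePoints_subset_extremePoints_of_subset hsub ⟨h, hext⟩)

lemma mpx_clamp (hM : IsMultiplex d n P x) (j : ℤ) :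
    x j = x (max 0 (min j n)) := by
  rcases le_total j 0 with h | h
  · rw [hM.clamp_lo j h]
    congr 1
    omega
  · rcases le_total (n : ℤ) j with h' | h'
    · rw [hM.clamp_hi j h']
      congr 1
      omega
    · congr 1
      omega

lemma mpx_image_sub (hM : IsMultiplex d n P x) (T : Set ℤ) :
    x '' T ⊆ x '' Icc (0:ℤ) n := by
  rintro _ ⟨j, _, rfl⟩
  rw [mpx_clamp hM]
  exact mem_image_of_mem x ⟨by omega, by omega⟩

lemma mpx_mem_facet_iff (hM : IsMultiplex d n P x) (m i : ℤ) (hm : m ∈ Icc (0:ℤ) n)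
    (hi : i ∈ Icc (0:ℤ) n) :
    x i ∈ convexHull ℝ (x '' (Icc (m - d + 1) (m + d - 1) \ {m})) ↔ mpxV d n m i := by
  have hd := hM.two_le_d
  rw [mpx_mem_hull_iff hM _ (mpx_image_sub hM _) i hi]
  obtain ⟨hm0, hmn⟩ := hm
  constructor
  · rintro ⟨j, ⟨⟨h1, h2⟩, h3⟩, hj⟩
    rw [mpx_clamp hM] at hj
    have := hM.inj ⟨by omega, by omega⟩ hi hj
    simp only [mem_singleton_iff] at h3
    unfold mpxV
    omega
  · rintro (h | ⟨h, h'⟩ | ⟨h, h'⟩)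
    · exact ⟨i, ⟨⟨h.1, h.2.1⟩, h.2.2⟩, rfl⟩
    · refine ⟨m - d + 1, ⟨⟨le_rfl, by omega⟩, ?_⟩, ?_⟩
      · simp only [mem_singleton_iff]
        omega
      · rw [h, hM.clamp_lo _ h']
    · refine ⟨m + d - 1, ⟨⟨by omega, le_rfl⟩, ?_⟩, ?_⟩
      · simp only [mem_singleton_iff]
        omega
      · rw [h, hM.clamp_hi _ h']

/-- An edge is the intersection of the facets that contain it. -/
lemma mpx_edge (hM : IsMultiplex d n P x) (i j k : ℤ) (hi : i ∈ Icc (0:ℤ) n)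
    (hj : j ∈ Icc (0:ℤ) n) (hk : k ∈ Icc (0:ℤ) n) (hki : k ≠ i) (hkj : k ≠ j)
    (hF : IsFaceOf P (convexHull ℝ ({x i, x j} : Set E))) :
    ∃ m ∈ Icc (0:ℤ) n, mpxV d n m i ∧ mpxV d n m j ∧ ¬ mpxV d n m k := by
  classical
  have hfin : (x '' Icc (0:ℤ) n).Finite := (finite_Icc _ _).image x
  set S : Finset E := hfin.toFinset with hS
  have hSc : (S : Set E) = x '' Icc (0:ℤ) n := hfin.coe_toFinset
  have hP : P = convexHull ℝ (S : Set E) := by rw [hSc, hM.hull]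
  have hxS : ∀ i ∈ Icc (0:ℤ) n, x i ∈ S := fun i hi => by
    rw [← Finset.mem_coe, hSc]
    exact mem_image_of_mem x hi
  have hxP : ∀ s ∈ S, s ∈ P := fun s hs => by
    rw [hP]
    exact subset_convexHull ℝ _ hs
  obtain ⟨l, c, hl, hlF⟩ := mpx_of_face P _ hF
  have hli : l (x i) = c :=
    (hlF _ (hxP _ (hxS i hi))).mp (subset_convexHull ℝ _ (by simp))
  have hlj : l (x j) = c :=
    (hlF _ (hxP _ (hxS j hj))).mp (subset_convexHull ℝ _ (by simp))
  have hlk : c < l (x k) := by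
    refine lt_of_le_of_ne (hl _ (hxP _ (hxS k hk))) fun h => ?_
    have h1 := (hlF _ (hxP _ (hxS k hk))).mpr h.symm
    rw [← image_pair, mpx_mem_hull_iff hM _ (mpx_image_sub hM _) k hk, image_pair] at h1
    rcases h1 with h1 | h1
    · exact hki (hM.inj hk hi h1)
    · exact hkj (hM.inj hk hj h1)
  obtain ⟨l', c', a1, a2, a3, a4⟩ := mpx_climb S (x k) (x i) (hxS k hk) (hxS i hi)
    (Module.finrank ℝ (vectorSpan ℝ (S : Set E))) l c (fun s hs => hl s (hxP s hs)) hli hlk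
    (by omega)
  have hdimP : Module.finrank ℝ (vectorSpan ℝ (S : Set E)) = d := by
    rw [← hM.dim, pdim, hP, affineSpan_convexHull, direction_affineSpan]
  have hface : IsFaceOf P (convexHull ℝ {s : E | s ∈ S ∧ l' s = c'}) := by
    rw [hP]
    exact mpx_exposed (S : Set E) l' c' a1 (x i) (hxS i hi) (a2 _ (hxS i hi) hli)
  have hdimF : pdim (convexHull ℝ {s : E | s ∈ S ∧ l' s = c'}) = d - 1 := by
    rw [pdim, affineSpan_convexHull, direction_affineSpan]
    omega
  obtain ⟨m, hm, hmF⟩ := (hM.facets _).mp ⟨hface, hdimF⟩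
  refine ⟨m, hm, ?_, ?_, ?_⟩
  · rw [← mpx_mem_facet_iff hM m i hm hi, ← hmF]
    exact subset_convexHull ℝ _ ⟨hxS i hi, a2 _ (hxS i hi) hli⟩
  · rw [← mpx_mem_facet_iff hM m j hm hj, ← hmF]
    exact subset_convexHull ℝ _ ⟨hxS j hj, a2 _ (hxS j hj) hlj⟩
  · rw [← mpx_mem_facet_iff hM m k hm hk, ← hmF]
    intro h
    have := mpx_face_eq (S : Set E) l' c' a1
    have h2 : x k ∈ convexHull ℝ {s : E | s ∈ (S : Set E) ∧ l' s = c'} := h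
    rw [← this] at h2
    exact a3.ne' h2.2

end

/-- Description of the edges of a multiplex. -/
lemma mpx_edge_char (d n : ℕ) (hd : 2 ≤ d) (hdn : d ≤ n) (a b : ℤ) (ha : 0 ≤ a) (hb : b ≤ n)
    (hab : a < b)
    (h : ∀ k : ℤ, 0 ≤ k → k ≤ n → k ≠ a → k ≠ b →
      ∃ m : ℤ, 0 ≤ m ∧ m ≤ n ∧ mpxV d n m a ∧ mpxV d n m b ∧ ¬ mpxV d n m k) :
    b - a ≤ d - 2 ∨ b - a = d ∨ (b - a = d - 1 ∧ (a = 0 ∨ b = n)) := by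
  by_contra hcon
  by_cases h1 : b - a = d - 1
  · obtain ⟨m, h⟩ := h (a - 1) (by omega) (by omega) (by omega) (by omega)
    unfold mpxV at h
    omega
  · obtain ⟨m, h⟩ := h (a + 1) (by omega) (by omega) (by omega) (by omega)
    unfold mpxV at h
    omega

/-- Combinatorial core: a clique is an intersection of facets. -/
lemma mpx_comb (d n : ℕ) (hd : 2 ≤ d) (hdn : d ≤ n) (X : Set ℤ) (hXne : X.Nonempty)
    (hX : X ⊆ Icc (0:ℤ) n)
    (hE : ∀ a ∈ X, ∀ b ∈ X, a < b →
      b - a ≤ d - 2 ∨ b - a = d ∨ (b - a = d - 1 ∧ (a = 0 ∨ b = n)))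
    (k : ℤ) (hk : k ∈ Icc (0:ℤ) n) (hkX : k ∉ X) :
    ∃ m ∈ Icc (0:ℤ) n, (∀ i ∈ X, mpxV d n m i) ∧ ¬ mpxV d n m k := by
  have hfin : X.Finite := (finite_Icc _ _).subset hX
  obtain ⟨a, haX, ha⟩ := exists_min_image X id hfin hXne
  obtain ⟨b, hbX, hb⟩ := exists_max_image X id hfin hXne
  simp only [id] at ha hb
  have ha0 := hX haX
  have hb0 := hX hbX
  simp only [mem_Icc] at ha0 hb0 hk
  have hab : a ≤ b := ha b hbX
  have hka : k ≠ a := fun h => hkX (h ▸ haX)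
  have hkb : k ≠ b := fun h => hkX (h ▸ hbX)
  have hbd : b - a ≤ d - 2 ∨ b - a = d ∨ (b - a = d - 1 ∧ (a = 0 ∨ b = n)) := by
    rcases hab.lt_or_eq with h | h
    · exact hE a haX b hbX h
    · omega
  have fin : ∀ m : ℤ, 0 ≤ m → m ≤ n → ¬ mpxV d n m k →
      (∀ i ∈ X, i ≠ k → a ≤ i → i ≤ b → (i ≠ a → i - a ≤ d - 2 ∨ i - a = d ∨ (i - a = d - 1 ∧ (a = 0 ∨ i = n))) →
        (i ≠ b → b - i ≤ d - 2 ∨ b - i = d ∨ (b - i = d - 1 ∧ (i = 0 ∨ b = n))) → mpxV d n m i) →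
      ∃ m ∈ Icc (0:ℤ) n, (∀ i ∈ X, mpxV d n m i) ∧ ¬ mpxV d n m k := by
    intro m h0 h1 h2 h3
    refine ⟨m, ⟨h0, h1⟩, fun i hi => h3 i hi (fun h => hkX (h ▸ hi)) (ha i hi) (hb i hi) ?_ ?_, h2⟩
    · intro hne
      exact hE a haX i hi (lt_of_le_of_ne (ha i hi) (Ne.symm hne))
    · intro hne
      exact hE i hi b hbX (lt_of_le_of_ne (hb i hi) hne)
  rcases lt_or_gt_of_ne hka with hlt | hgt
  · -- `k` lies below `X`
    by_cases hc1 : b - a ≤ d - 2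
    · by_cases hc2 : b - d + 2 ≤ k ∧ k ≠ 0
      · apply fin k <;> (try unfold mpxV) <;> intros <;> omega
      · by_cases hc3 : k = 0
        · by_cases hc4 : b ≤ d - 2
          · apply fin d <;> (try unfold mpxV) <;> intros <;> omega
          · by_cases hc5 : b = n
            · apply fin n <;> (try unfold mpxV) <;> intros <;> omega
            · apply fin (b + 1) <;> (try unfold mpxV) <;> intros <;> omega
        · by_cases hc5 : b = n
          · by_cases hc6 : n - d + 1 ≤ k
            · apply fin k <;> (try unfold mpxV) <;> intros <;> omega
            · apply fin n <;> (try unfold mpxV) <;> intros <;> omega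
          · apply fin (b + 1) <;> (try unfold mpxV) <;> intros <;> omega
    · by_cases hc2 : b - a = d
      · apply fin (a + d - 1) <;> (try unfold mpxV) <;> intros <;> omega
      · apply fin n <;> (try unfold mpxV) <;> intros <;> omega
  · rcases lt_or_gt_of_ne hkb with hlt2 | hgt2
    · apply fin k <;> (try unfold mpxV) <;> intros <;> omega
    · -- `k` lies above `X`
      by_cases hc1 : b - a ≤ d - 2
      · by_cases hc2 : k ≤ a + d - 2 ∧ k ≠ n
        · apply fin k <;> (try unfold mpxV) <;> intros <;> omega
        · by_cases hc3 : k = n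
          · by_cases hc4 : n - d + 2 ≤ a
            · apply fin (n - d) <;> (try unfold mpxV) <;> intros <;> omega
            · by_cases hc5 : a = 0
              · apply fin 0 <;> (try unfold mpxV) <;> intros <;> omega
              · apply fin (a - 1) <;> (try unfold mpxV) <;> intros <;> omega
          · by_cases hc5 : a = 0
            · by_cases hc6 : k ≤ d - 1
              · apply fin k <;> (try unfold mpxV) <;> intros <;> omega
              · apply fin 0 <;> (try unfold mpxV) <;> intros <;> omega
            · apply fin (a - 1) <;> (try unfold mpxV) <;> intros <;> omega
      · by_cases hc2 : b - a = d
        · apply fin (a + 1) <;> (try unfold mpxV) <;> intros <;> omega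
        · apply fin 0 <;> (try unfold mpxV) <;> intros <;> omega

/-- A functional cutting out exactly the vertices of a clique. -/
lemma mpx_clique_functional {d n : ℕ} {P : Set E} {x : ℤ → E} (hM : IsMultiplex d n P x)
    (X : Set ℤ) (hXne : X.Nonempty) (hX : X ⊆ Icc (0:ℤ) (n:ℤ))
    (hadj : ∀ i ∈ X, ∀ j ∈ X, i ≠ j → IsFaceOf P (convexHull ℝ ({x i, x j} : Set E))) :
    ∃ l : StrongDual ℝ E, ∃ c : ℝ, ∀ i ∈ Icc (0:ℤ) n, c ≤ l (x i) ∧ (l (x i) = c ↔ i ∈ X) := by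
  classical
  have hxP : ∀ i ∈ Icc (0:ℤ) n, x i ∈ P := fun i hi => by
    rw [hM.hull]
    exact subset_convexHull ℝ _ (mem_image_of_mem x hi)
  have hE : ∀ a ∈ X, ∀ b ∈ X, a < b →
      b - a ≤ d - 2 ∨ b - a = d ∨ (b - a = d - 1 ∧ (a = 0 ∨ b = n)) := by
    intro a ha b hb hab
    apply mpx_edge_char d n hM.two_le_d hM.d_le_n a b (hX ha).1 (hX hb).2 hab
    intro k hk0 hkn hka hkb
    obtain ⟨m, hm, h⟩ := mpx_edge hM a b k (hX ha) (hX hb) ⟨hk0, hkn⟩ hka hkb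
      (hadj a ha b hb hab.ne)
    exact ⟨m, hm.1, hm.2, h⟩
  have hfun : ∀ k : ℤ, ∃ l : StrongDual ℝ E, ∃ c : ℝ, k ∈ Icc (0:ℤ) n → k ∉ X →
      (∀ i ∈ Icc (0:ℤ) n, c ≤ l (x i)) ∧ (∀ i ∈ X, l (x i) = c) ∧ c < l (x k) := by
    intro k
    by_cases hk : k ∈ Icc (0:ℤ) n ∧ k ∉ X
    · obtain ⟨m, hm, hmX, hmk⟩ := mpx_comb d n hM.two_le_d hM.d_le_n X hXne hX hE k hk.1 hk.2
      obtain ⟨hF, _⟩ := (hM.facets _).mpr ⟨m, hm, rfl⟩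
      obtain ⟨l, c, h1, h2⟩ := mpx_of_face P _ hF
      refine ⟨l, c, fun _ _ => ⟨fun i hi => h1 _ (hxP i hi), fun i hi => ?_, ?_⟩⟩
      · rw [← h2 _ (hxP i (hX hi)), mpx_mem_facet_iff hM m i hm (hX hi)]
        exact hmX i hi
      · refine lt_of_le_of_ne (h1 _ (hxP k hk.1)) fun h => hmk ?_
        rw [← mpx_mem_facet_iff hM m k hm hk.1, h2 _ (hxP k hk.1)]
        exact h.symm
    · exact ⟨0, 0, fun h1 h2 => absurd ⟨h1, h2⟩ hk⟩
  choose l c hlc using hfun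
  set T : Finset ℤ := (Finset.Icc (0:ℤ) n).filter (· ∉ X) with hT
  have hTm : ∀ k ∈ T, k ∈ Icc (0:ℤ) n ∧ k ∉ X := by
    intro k hk
    simpa [hT] using hk
  refine ⟨∑ k ∈ T, l k, ∑ k ∈ T, c k, fun i hi => ?_⟩
  simp only [ContinuousLinearMap.sum_apply]
  have hle : ∀ k ∈ T, c k ≤ l k (x i) := fun k hk =>
    (hlc k (hTm k hk).1 (hTm k hk).2).1 i hi
  refine ⟨Finset.sum_le_sum hle, ?_, ?_⟩
  · intro heq
    by_contra hiX
    have hiT : i ∈ T := by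
      rw [hT, Finset.mem_filter, Finset.mem_Icc]
      exact ⟨hi, hiX⟩
    exact (Finset.sum_lt_sum hle ⟨i, hiT, (hlc i hi hiX).2.2⟩).ne' heq
  · intro hiX
    exact Finset.sum_congr rfl fun k hk => (hlc k (hTm k hk).1 (hTm k hk).2).2.1 i hiX

/-- Every complete subgraph of the graph of a multiplex is the graph of a face of
the multiplex: if the vertices indexed by `X` are pairwise joined by edges of
`M^{d,n}`, then they span a face of `M^{d,n}`, and that face is a simplex
(its vertices are affinely independent). -/
theorem multiplex_complete_subgraph_is_simplex_face (d n : ℕ) (hd : 2 ≤ d)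
    (hdn : d ≤ n) (P : Set E) (x : ℤ → E) (hM : IsMultiplex d n P x)
    (X : Set ℤ) (hXne : X.Nonempty) (hX : X ⊆ Icc (0:ℤ) (n:ℤ))
    (hadj : ∀ i ∈ X, ∀ j ∈ X, i ≠ j →
      IsFaceOf P (convexHull ℝ ({x i, x j} : Set E)) ∧
        pdim (convexHull ℝ ({x i, x j} : Set E)) = 1) :
    IsFaceOf P (convexHull ℝ (x '' X)) ∧
      AffineIndependent ℝ (fun p : (x '' X) => (p : E)) := by
  constructor
  · obtain ⟨l, c, h⟩ := mpx_clique_functional hM X hXne hX (fun i hi j hj hij => (hadj i hi j hj hij).1)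
    obtain ⟨q, hq⟩ := hXne
    have h1 := mpx_exposed (x '' Icc (0:ℤ) n) l c (by
      rintro _ ⟨i, hi, rfl⟩
      exact (h i hi).1) (x q) (mem_image_of_mem x (hX hq)) ((h q (hX hq)).2.mpr hq)
    rw [← hM.hull] at h1
    convert h1 using 2
    ext y
    constructor
    · rintro ⟨i, hi, rfl⟩
      exact ⟨mem_image_of_mem x (hX hi), (h i (hX hi)).2.mpr hi⟩
    · rintro ⟨⟨i, hi, rfl⟩, h2⟩
      exact mem_image_of_mem x ((h i hi).2.mp h2)
  · rw [affineIndependent_iff]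
    intro s w hw0 hws p hp
    obtain ⟨_, a, ha, rfl⟩ := p
    -- a functional vanishing exactly on the other vertices
    have hfun : ∃ l : StrongDual ℝ E, ∃ c : ℝ, (∀ i ∈ X, i ≠ a → l (x i) = c) ∧ l (x a) ≠ c := by
      by_cases hne : (X \ {a}).Nonempty
      · obtain ⟨l, c, h⟩ := mpx_clique_functional hM (X \ {a}) hne (fun i hi => hX hi.1)
          (fun i hi j hj hij => (hadj i hi.1 j hj.1 hij).1)
        refine ⟨l, c, fun i hi hia => (h i (hX hi)).2.mpr ⟨hi, hia⟩, fun he => ?_⟩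
        exact ((h a (hX ha)).2.mp he).2 rfl
      · refine ⟨0, 1, fun i hi hia => absurd ⟨i, hi, hia⟩ hne, by simp⟩
    obtain ⟨l, c, h1, h2⟩ := hfun
    have h3 : ∑ e ∈ s, w e * (l (e : E) - c) = 0 := by
      have := congrArg l hws
      rw [map_sum, map_zero] at this
      simp only [map_smul, smul_eq_mul] at this
      simp only [mul_sub, Finset.sum_sub_distrib, ← Finset.sum_mul, hw0, this]
      ring
    rw [Finset.sum_eq_single_of_mem _ hp] at h3
    · exact (mul_eq_zero.mp h3).resolve_right (sub_ne_zero.mpr h2)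
    · rintro ⟨_, i, hi, rfl⟩ _ hne
      rw [h1 i hi (fun h => hne (by subst h; rfl)), sub_self, mul_zero]
end
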